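/- arXiv:math/0308251 — 2 statements merged into one kernel-verified Lean document; each statement's English description precedes it below -/
import Mathlib

section
/- Let E, F ⊆ ℝ^d be bands, let A_1,…,A_n and B_1,…,B_n be invertible real d×d matrices, and suppose the sampling transforms Θ_A of A = {A_j z : j, z ∈ ℤ^d} and Θ_B of B = {B_j z : j, z ∈ ℤ^d} (no shifts) are bounded on V_E and V_F respectively. Then the samples A and B are orthogonal on E and F if and only if for each j = 1,…,n, (Σ_{p∈ℤ^d} χ_E(A_j^{*-1}(ξ+p))) · (Σ_{q∈ℤ^d} χ_F(B_j^{*-1}(ξ+q))) = 0 for a.e. ξ ∈ ℝ^d. Equivalently, A and B are orthogonal on E and F if and only if for each j the single-lattice samples {A_j z : z ∈ ℤ^d} and {B_j z : z ∈ ℤ^d} are orthogonal on E and F. -/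
open MeasureTheory Complex Matrix
open scoped FourierTransform ENNReal NNReal RealInnerProductSpace Classical

noncomputable section

namespace GSL

/-- Euclidean space `ℝ^d`. -/
abbrev Rd (d : ℕ) := EuclideanSpace ℝ (Fin d)

/-- `L²(ℝ^d, ℂ)`. -/
abbrev L2 (d : ℕ) := Lp ℂ 2 (volume : Measure (Rd d))

/-- The point of `ℝ^d` corresponding to `z ∈ ℤ^d`. -/
def zv {d : ℕ} (z : Fin d → ℤ) : Rd d :=
  (EuclideanSpace.equiv (Fin d) ℝ).symm fun i => (z i : ℝ)

/-- Apply a real `d × d` matrix to a vector of `ℝ^d`. -/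
def mApp {d : ℕ} (A : Matrix (Fin d) (Fin d) ℝ) (x : Rd d) : Rd d :=
  (EuclideanSpace.equiv (Fin d) ℝ).symm (A.mulVec (EuclideanSpace.equiv (Fin d) ℝ x))

/-- `F` is the Fourier–Plancherel transform of `L²(ℝ^d)`: the (unique) isometric isomorphism
agreeing a.e. with the Fourier integral `𝓕 f (ξ) = ∫ f x e^{-2πi x·ξ} dx` on `L¹ ∩ L²`. -/
def IsFourier {d : ℕ} (F : L2 d ≃ₗᵢ[ℂ] L2 d) : Prop :=
  ∀ f : L2 d, Integrable (f : Rd d → ℂ) volume →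
    (F f : Rd d → ℂ) =ᵐ[volume] 𝓕 (f : Rd d → ℂ)

/-- A band: a measurable set of finite Lebesgue measure. -/
def IsBand {d : ℕ} (E : Set (Rd d)) : Prop := MeasurableSet E ∧ volume E < ⊤

/-- `V_E`: elements of `L²` whose Fourier transform vanishes a.e. outside `E`. -/
def Vband {d : ℕ} (F : L2 d ≃ₗᵢ[ℂ] L2 d) (E : Set (Rd d)) : Set (L2 d) :=
  {f | ∀ᵐ ξ ∂(volume : Measure (Rd d)), ξ ∉ E → (F f : Rd d → ℂ) ξ = 0}

/-- `f₀` is the continuous representative of `f ∈ L²`. -/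
def IsCRep {d : ℕ} (f : L2 d) (f₀ : Rd d → ℂ) : Prop :=
  Continuous f₀ ∧ (f : Rd d → ℂ) =ᵐ[volume] f₀

/-- The pairing `⟨f, T_y g⟩ = ∫ f(x) conj(g(x-y)) dx` (linear in the first variable). -/
def pair {d : ℕ} (f g : L2 d) (y : Rd d) : ℂ :=
  ∫ x, (f : Rd d → ℂ) x * (starRingEnd ℂ) ((g : Rd d → ℂ) (x - y))

/-- `‖Θ_A f‖²` for the samples `{A_j z + β_j}`, computed in `[0,∞]`. -/
def sampleSum {d n : ℕ} (A : Fin n → Matrix (Fin d) (Fin d) ℝ) (β : Fin n → Rd d)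
    (f₀ : Rd d → ℂ) : ℝ≥0∞ :=
  ∑' (j : Fin n) (z : Fin d → ℤ), (‖f₀ (mApp (A j) (zv z) + β j)‖₊ : ℝ≥0∞) ^ 2

/-- `‖Θ f‖²` for the single-lattice samples `{A z + β}`. -/
def sampleSum1 {d : ℕ} (A : Matrix (Fin d) (Fin d) ℝ) (β : Rd d) (f₀ : Rd d → ℂ) : ℝ≥0∞ :=
  ∑' z : Fin d → ℤ, (‖f₀ (mApp A (zv z) + β)‖₊ : ℝ≥0∞) ^ 2

/-- The sampling transform of `{A_j z + β_j}` is (well defined and) bounded on `V_E`. -/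
def ThetaBounded {d n : ℕ} (F : L2 d ≃ₗᵢ[ℂ] L2 d) (E : Set (Rd d))
    (A : Fin n → Matrix (Fin d) (Fin d) ℝ) (β : Fin n → Rd d) : Prop :=
  ∃ M : ℝ≥0∞, M < ⊤ ∧ ∀ f ∈ Vband F E, ∀ f₀, IsCRep f f₀ →
    sampleSum A β f₀ ≤ M * (‖f‖₊ : ℝ≥0∞) ^ 2

/-- The samples `{A_j z + β_j}` are tight on the band `E` with constant `K`. -/
def Tight {d n : ℕ} (F : L2 d ≃ₗᵢ[ℂ] L2 d) (E : Set (Rd d))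
    (A : Fin n → Matrix (Fin d) (Fin d) ℝ) (β : Fin n → Rd d) (K : ℝ≥0) : Prop :=
  ∀ f ∈ Vband F E, ∀ f₀, IsCRep f f₀ →
    sampleSum A β f₀ = (K : ℝ≥0∞) * (‖f‖₊ : ℝ≥0∞) ^ 2

/-- The single-lattice samples `{A z + β}` are tight on the band `E` with constant `K`. -/
def Tight1 {d : ℕ} (F : L2 d ≃ₗᵢ[ℂ] L2 d) (E : Set (Rd d))
    (A : Matrix (Fin d) (Fin d) ℝ) (β : Rd d) (K : ℝ≥0) : Prop :=
  ∀ f ∈ Vband F E, ∀ f₀, IsCRep f f₀ →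
    sampleSum1 A β f₀ = (K : ℝ≥0∞) * (‖f‖₊ : ℝ≥0∞) ^ 2

/-- Orthogonality of the samples `{A_j z + β_j}` and `{B_j z + γ_j}` on bands `E`, `F'`:
the ranges of the two sampling transforms are orthogonal in `⊕ⁿ ℓ²(ℤ^d)`. -/
def Orth {d n : ℕ} (F : L2 d ≃ₗᵢ[ℂ] L2 d) (E F' : Set (Rd d))
    (A : Fin n → Matrix (Fin d) (Fin d) ℝ) (β : Fin n → Rd d)
    (B : Fin n → Matrix (Fin d) (Fin d) ℝ) (γ : Fin n → Rd d) : Prop :=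
  ∀ f ∈ Vband F E, ∀ g ∈ Vband F F', ∀ f₀ g₀, IsCRep f f₀ → IsCRep g g₀ →
    ∑' (j : Fin n) (z : Fin d → ℤ),
      f₀ (mApp (A j) (zv z) + β j) * (starRingEnd ℂ) (g₀ (mApp (B j) (zv z) + γ j)) = 0

/-- Single-lattice orthogonality of `{A z + β}` and `{B z + γ}` on bands `E`, `F'`. -/
def Orth1 {d : ℕ} (F : L2 d ≃ₗᵢ[ℂ] L2 d) (E F' : Set (Rd d))
    (A : Matrix (Fin d) (Fin d) ℝ) (β : Rd d)
    (B : Matrix (Fin d) (Fin d) ℝ) (γ : Rd d) : Prop :=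
  ∀ f ∈ Vband F E, ∀ g ∈ Vband F F', ∀ f₀ g₀, IsCRep f f₀ → IsCRep g g₀ →
    ∑' z : Fin d → ℤ,
      f₀ (mApp A (zv z) + β) * (starRingEnd ℂ) (g₀ (mApp B (zv z) + γ)) = 0

/-- Membership in `Λ = ∪_p C_p^{*-1} ℤ^d`. -/
def memLambda {d : ℕ} {P : Type*} (C : P → Matrix (Fin d) (Fin d) ℝ) (α : Rd d) : Prop :=
  ∃ (p : P) (z : Fin d → ℤ), α = mApp ((C p)ᵀ)⁻¹ (zv z)

/-- Membership in `P_α = {p : C_p^* α ∈ ℤ^d}`. -/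
def memPalpha {d : ℕ} {P : Type*} (C : P → Matrix (Fin d) (Fin d) ℝ) (α : Rd d) (p : P) :
    Prop :=
  ∃ z : Fin d → ℤ, mApp (C p)ᵀ α = zv z

/-- The system `{T_{C_p k} g_p}` is Bessel. -/
def Bessel {d : ℕ} {P : Type*} (C : P → Matrix (Fin d) (Fin d) ℝ) (g : P → L2 d) : Prop :=
  ∃ M : ℝ≥0∞, M < ⊤ ∧ ∀ f : L2 d,
    ∑' (p : P) (k : Fin d → ℤ), (‖pair f (g p) (mApp (C p) (zv k))‖₊ : ℝ≥0∞) ^ 2 ≤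
      M * (‖f‖₊ : ℝ≥0∞) ^ 2

/-- Membership in `D = {f ∈ L² : f̂ ∈ L^∞ with compact support}`. -/
def MemD {d : ℕ} (F : L2 d ≃ₗᵢ[ℂ] L2 d) (f : L2 d) : Prop :=
  (∃ C : ℝ, ∀ᵐ ξ ∂(volume : Measure (Rd d)), ‖(F f : Rd d → ℂ) ξ‖ ≤ C) ∧
  (∃ R : ℝ, ∀ᵐ ξ ∂(volume : Measure (Rd d)), (F f : Rd d → ℂ) ξ ≠ 0 → ‖ξ‖ ≤ R)

/-- The local boundedness condition for the system `{T_{C_p k} g_p}`. -/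
def LocBound {d : ℕ} {P : Type*} (F : L2 d ≃ₗᵢ[ℂ] L2 d)
    (C : P → Matrix (Fin d) (Fin d) ℝ) (g : P → L2 d) : Prop :=
  ∀ f : L2 d, MemD F f →
    ∑' (p : P) (k : Fin d → ℤ),
      ∫⁻ ξ in {ξ : Rd d | (F f : Rd d → ℂ) ξ ≠ 0},
        (‖(F f : Rd d → ℂ) (ξ + mApp ((C p)ᵀ)⁻¹ (zv k))‖₊ : ℝ≥0∞) ^ 2 *
          ENNReal.ofReal |(C p).det|⁻¹ * (‖(F (g p) : Rd d → ℂ) ξ‖₊ : ℝ≥0∞) ^ 2 < ⊤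

/-- `T` is the family of translation operators on `L²`: `T_y f (x) = f (x - y)`. -/
def IsTrans {d : ℕ} (T : Rd d → L2 d → L2 d) : Prop :=
  ∀ (y : Rd d) (f : L2 d),
    (T y f : Rd d → ℂ) =ᵐ[volume] fun x => (f : Rd d → ℂ) (x - y)

/-- `Ω` is the operator `f ↦ Σ_p Σ_k ⟨f, T_{C_p k} g_p⟩ T_{D_p k} h_p`
(the series converging unconditionally in `L²`). -/
def IsOmega {d : ℕ} {P : Type*} (T : Rd d → L2 d → L2 d)
    (C D : P → Matrix (Fin d) (Fin d) ℝ) (g h : P → L2 d) (Ω : L2 d → L2 d) : Prop :=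
  ∀ f : L2 d,
    HasSum (fun pk : P × (Fin d → ℤ) =>
      pair f (g pk.1) (mApp (C pk.1) (zv pk.2)) • T (mApp (D pk.1) (zv pk.2)) (h pk.1)) (Ω f)

/-- The sum `Σ_{p ∈ P_α} |det C_p|⁻¹ conj(ĝ_p(ξ)) ĥ_p(ξ + α)`. -/
def alphaSum {d : ℕ} {P : Type*} (F : L2 d ≃ₗᵢ[ℂ] L2 d)
    (C : P → Matrix (Fin d) (Fin d) ℝ) (g h : P → L2 d) (α ξ : Rd d) : ℂ :=
  ∑' p : {p : P // memPalpha C α p},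
    ((|(C p.1).det|⁻¹ : ℝ) : ℂ) * (starRingEnd ℂ) ((F (g p.1) : Rd d → ℂ) ξ) *
      (F (h p.1) : Rd d → ℂ) (ξ + α)

/-- The unit cube `[0,1]^d`. -/
def cube (d : ℕ) : Set (Rd d) := {x | ∀ i, x i ∈ Set.Icc (0 : ℝ) 1}

/-- The `C` bracket product `[f,g]_C(ξ) = Σ_m f(ξ + Cm) conj(g(ξ + Cm))`. -/
def bracket {d : ℕ} (C : Matrix (Fin d) (Fin d) ℝ) (f g : Rd d → ℂ) (ξ : Rd d) : ℂ :=
  ∑' m : Fin d → ℤ, f (ξ + mApp C (zv m)) * (starRingEnd ℂ) (g (ξ + mApp C (zv m)))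

lemma continuous_fourierInv {d : ℕ} {u : Rd d → ℂ} (hu : Integrable u volume) :
    Continuous (𝓕⁻ u) := by
  rw [Real.fourierInv_eq_fourier_comp_neg]
  exact VectorFourier.fourierIntegral_continuous Real.continuous_fourierChar
    (by exact continuous_inner) hu.comp_neg

lemma ae_eq_fourierInv {d : ℕ} {F : L2 d ≃ₗᵢ[ℂ] L2 d} (hF : IsFourier F) (f : L2 d)
    (hf : Integrable (F f : Rd d → ℂ) volume) :
    (f : Rd d → ℂ) =ᵐ[volume] 𝓕⁻ (F f : Rd d → ℂ) := by
  refine ae_eq_of_integral_contDiff_smul_eq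
    ((Lp.memLp f).locallyIntegrable one_le_two)
    (continuous_fourierInv hf).locallyIntegrable ?_
  intro g hg hgs
  have hgc : Continuous fun x => (g x : ℂ) := Complex.continuous_ofReal.comp hg.continuous
  have hgs' : HasCompactSupport fun x => (g x : ℂ) :=
    hgs.comp_left (g := fun r : ℝ => (r : ℂ)) Complex.ofReal_zero
  have hgm := hgc.memLp_of_hasCompactSupport (p := 2) (μ := volume) hgs'
  have hgi : Integrable (fun x => (g x : ℂ)) volume := hgc.integrable_of_hasCompactSupport hgs'
  set G : L2 d := hgm.toLp _ with hG
  have hGe : (G : Rd d → ℂ) =ᵐ[volume] fun x => (g x : ℂ) := hgm.coeFn_toLp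
  have hFG : (F G : Rd d → ℂ) =ᵐ[volume] 𝓕 (fun x => (g x : ℂ)) := by
    refine (hF G (hgi.congr hGe.symm)).trans (Filter.Eventually.of_forall fun x => ?_)
    exact Real.fourier_congr_ae hGe x
  have h1 : ∫ x, g x • (f : Rd d → ℂ) x = inner ℂ G f := by
    rw [L2.inner_def]
    refine integral_congr_ae ?_
    filter_upwards [hGe] with x hx
    simp [hx, mul_comm]
  rw [h1, ← F.inner_map_map, L2.inner_def]
  have h2 : ∫ x, inner ℂ ((F G : Rd d → ℂ) x) ((F f : Rd d → ℂ) x) =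
      ∫ x, (innerSL ℂ) (𝓕 (fun x => (g x : ℂ)) x) ((F f : Rd d → ℂ) x) := by
    refine integral_congr_ae ?_
    filter_upwards [hFG] with x hx
    simp [hx]
  rw [h2]
  have h3 := VectorFourier.integral_sesq_fourierIntegral_eq_neg_flip (L := innerₗ (Rd d))
    (μ := volume) (ν := volume) (innerSL ℂ) Real.continuous_fourierChar
    (by exact continuous_inner) hgi hf
  refine h3.trans (integral_congr_ae (Filter.Eventually.of_forall fun x => ?_))
  have h4 : VectorFourier.fourierIntegral Real.fourierChar volume (-(innerₗ (Rd d)).flip)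
      (F f : Rd d → ℂ) x = 𝓕⁻ (F f : Rd d → ℂ) x := by
    rw [Real.fourierInv_eq, VectorFourier.fourierIntegral]
    simp
  simp only [h4]
  simp [mul_comm]

lemma ae_eq_zero_of_forall_integral_continuousMap_mul_eq_zero {X : Type*} [PseudoEMetricSpace X]
    [MeasurableSpace X] [BorelSpace X] {μ : Measure X} {v : X → ℂ}
    (hv : Integrable v μ) (h : ∀ c : C(X, ℂ), ∫ x, c x * v x ∂μ = 0) : v =ᵐ[μ] 0 := by
  refine ae_eq_zero_of_forall_setIntegral_isClosed_eq_zero hv fun s hs => ?_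
  have hδ : ∀ n : ℕ, (0 : ℝ) < 1 / ((n : ℝ) + 1) := fun n => Nat.one_div_pos_of_nat
  let c : ℕ → C(X, ℂ) := fun n =>
    ⟨fun x => ((thickenedIndicator (hδ n) s x : ℝ≥0) : ℝ), by fun_prop⟩
  have hc : ∀ n x, ‖c n x‖ ≤ 1 := fun n x => by
    have : thickenedIndicator (hδ n) s x ≤ 1 := thickenedIndicator_le_one (hδ n) s x
    simpa [c] using this
  have ht : Filter.Tendsto (fun n => ∫ x, c n x * v x ∂μ) Filter.atTop
      (nhds (∫ x, s.indicator v x ∂μ)) := by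
    refine tendsto_integral_of_dominated_convergence (fun x => ‖v x‖)
      (fun n => (c n).continuous.aestronglyMeasurable.mul hv.1) hv.norm
      (fun n => Filter.Eventually.of_forall fun x => ?_)
      (Filter.Eventually.of_forall fun x => ?_)
    · rw [norm_mul]
      exact mul_le_of_le_one_left (norm_nonneg _) (hc n x)
    · have h1 := tendsto_pi_nhds.1 (thickenedIndicator_tendsto_indicator_closure hδ
        tendsto_one_div_add_atTop_nhds_zero_nat s) x
      rw [hs.closure_eq] at h1
      have h2 : Filter.Tendsto (fun n => c n x) Filter.atTop
          (nhds (((s.indicator (fun _ => (1 : ℝ≥0)) x : ℝ≥0) : ℝ) : ℂ)) :=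
        (Complex.continuous_ofReal.tendsto _).comp ((NNReal.continuous_coe.tendsto _).comp h1)
      have h3 := h2.mul_const (v x)
      by_cases hx : x ∈ s <;> simpa [hx] using h3
  simp only [h] at ht
  rw [← integral_indicator hs.measurableSet]
  exact tendsto_nhds_unique ht tendsto_const_nhds

/-- Lebesgue measure on the circle `ℝ / ℤ`, normalised to have total mass one. -/
@[reducible] def unitCircleMeasureSpace : MeasureSpace UnitAddCircle :=
  ⟨AddCircle.haarAddCircle⟩

attribute [local instance] unitCircleMeasureSpace

lemma isProbabilityMeasure_volume_unitAddCircle :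
    IsProbabilityMeasure (volume : Measure UnitAddCircle) :=
  inferInstanceAs (IsProbabilityMeasure AddCircle.haarAddCircle)

attribute [local instance] isProbabilityMeasure_volume_unitAddCircle

lemma ae_eq_zero_of_mFourierCoeff_eq_zero {d : ℕ} {v : UnitAddTorus (Fin d) → ℂ}
    (hv : Integrable v volume) (h : ∀ n, UnitAddTorus.mFourierCoeff v n = 0) :
    v =ᵐ[volume] 0 := by
  refine ae_eq_zero_of_forall_integral_continuousMap_mul_eq_zero hv fun c => ?_
  have hint : ∀ c : C(UnitAddTorus (Fin d), ℂ), Integrable (fun x => c x * v x) volume := fun c =>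
    hv.bdd_mul c.continuous.aestronglyMeasurable (Filter.Eventually.of_forall c.norm_coe_le_norm)
  let T : C(UnitAddTorus (Fin d), ℂ) →ₗ[ℂ] ℂ :=
    { toFun := fun c => ∫ x, c x * v x
      map_add' := fun a b => by
        simp only [ContinuousMap.add_apply, add_mul]
        exact integral_add (hint a) (hint b)
      map_smul' := fun r a => by
        simp only [ContinuousMap.smul_apply, smul_eq_mul, mul_assoc, RingHom.id_apply]
        exact integral_const_mul _ _ }
  have hT : Continuous T := by
    refine (T.mkContinuous (∫ x, ‖v x‖) fun c => ?_).continuous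
    calc ‖∫ x, c x * v x‖ ≤ ∫ x, ‖c x * v x‖ := norm_integral_le_integral_norm _
      _ ≤ ∫ x, ‖c‖ * ‖v x‖ := by
        refine integral_mono (hint c).norm (hv.norm.const_mul _) fun x => ?_
        simp only [norm_mul]
        exact mul_le_mul_of_nonneg_right (c.norm_coe_le_norm x) (norm_nonneg _)
      _ = (∫ x, ‖v x‖) * ‖c‖ := by rw [integral_const_mul, mul_comm]
  have hker : IsClosed {c | T c = 0} := isClosed_eq hT continuous_const
  have hspan : ∀ c ∈ Submodule.span ℂ (Set.range (UnitAddTorus.mFourier (d := Fin d))),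
      T c = 0 := by
    intro c hc
    have : Submodule.span ℂ (Set.range (UnitAddTorus.mFourier (d := Fin d))) ≤ T.ker := by
      rw [Submodule.span_le]
      rintro _ ⟨n, rfl⟩
      have := h (-n)
      rw [UnitAddTorus.mFourierCoeff, neg_neg] at this
      exact this
    exact this hc
  have hmem : c ∈ (Submodule.span ℂ
      (Set.range (UnitAddTorus.mFourier (d := Fin d)))).topologicalClosure := by
    rw [UnitAddTorus.span_mFourier_closure_eq_top]; trivial
  exact closure_minimal hspan hker hmem

lemma memLp_two_of_summable_mFourierCoeff {d : ℕ} {v : UnitAddTorus (Fin d) → ℂ}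
    (hv : Integrable v volume) (h : Summable fun n => ‖UnitAddTorus.mFourierCoeff v n‖ ^ 2) :
    MemLp v 2 volume := by
  have hl : Memℓp (fun n => UnitAddTorus.mFourierCoeff v n) 2 := by
    rw [memℓp_gen_iff (by simp)]
    simpa using h
  let g := (UnitAddTorus.mFourierBasis (d := Fin d)).repr.symm ⟨_, hl⟩
  have hg : ∀ n, UnitAddTorus.mFourierCoeff g n = UnitAddTorus.mFourierCoeff v n := fun n => by
    rw [← UnitAddTorus.mFourierBasis_repr]
    simp [g]
  have hgm : MemLp (g : UnitAddTorus (Fin d) → ℂ) 2 volume := Lp.memLp g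
  have hgi : Integrable (g : UnitAddTorus (Fin d) → ℂ) volume := hgm.integrable one_le_two
  have hint : ∀ (w : UnitAddTorus (Fin d) → ℂ), Integrable w volume →
      ∀ n : Fin d → ℤ, Integrable (fun x => UnitAddTorus.mFourier (-n) x • w x) volume :=
    fun w hw n => hw.bdd_smul 1 (UnitAddTorus.mFourier (-n)).continuous.aestronglyMeasurable
      (Filter.Eventually.of_forall fun x => ((UnitAddTorus.mFourier (-n)).norm_coe_le_norm x).trans
        UnitAddTorus.mFourier_norm.le)
  have h0 := ae_eq_zero_of_mFourierCoeff_eq_zero (hgi.sub hv) fun n => by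
    rw [UnitAddTorus.mFourierCoeff]
    simp only [Pi.sub_apply, smul_sub]
    rw [integral_sub (hint _ hgi n) (hint _ hv n)]
    exact sub_eq_zero.2 (hg n)
  refine hgm.ae_eq ?_
  filter_upwards [h0] with x hx
  exact sub_eq_zero.1 hx

lemma hasSum_mFourierCoeff_mul_conj {d : ℕ} {v w : UnitAddTorus (Fin d) → ℂ}
    (hv : Integrable v volume) (hw : Integrable w volume)
    (hvs : Summable fun n => ‖UnitAddTorus.mFourierCoeff v n‖ ^ 2)
    (hws : Summable fun n => ‖UnitAddTorus.mFourierCoeff w n‖ ^ 2) :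
    Integrable (fun x => v x * (starRingEnd ℂ) (w x)) volume ∧
    HasSum (fun n => UnitAddTorus.mFourierCoeff v n *
      (starRingEnd ℂ) (UnitAddTorus.mFourierCoeff w n))
      (∫ x, v x * (starRingEnd ℂ) (w x)) := by
  have hv2 := memLp_two_of_summable_mFourierCoeff hv hvs
  have hw2 := memLp_two_of_summable_mFourierCoeff hw hws
  refine ⟨hv2.integrable_mul hw2.star, ?_⟩
  have hcoe : ∀ {u : UnitAddTorus (Fin d) → ℂ} (hu : MemLp u 2 volume) n,
      UnitAddTorus.mFourierCoeff (hu.toLp u) n = UnitAddTorus.mFourierCoeff u n := by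
    intro u hu n
    refine integral_congr_ae ?_
    filter_upwards [hu.coeFn_toLp] with x hx
    rw [hx]
  have h := UnitAddTorus.hasSum_prod_mFourierCoeff (hw2.toLp w) (hv2.toLp v)
  simp only [hcoe] at h
  convert h using 1
  · funext n; rw [mul_comm]
  · refine integral_congr_ae ?_
    filter_upwards [hv2.coeFn_toLp, hw2.coeFn_toLp] with x h1 h2
    rw [h1, h2, mul_comm]

/-- The half-open unit cube `(0,1]^d`. -/
def unitCube (d : ℕ) : Set (Fin d → ℝ) := {x | ∀ i, x i ∈ Set.Ioc (0 : ℝ) (0 + 1)}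

/-- An integer vector as a point of `Fin d → ℝ`. -/
def intVec {d : ℕ} (k : Fin d → ℤ) : Fin d → ℝ := fun i => (k i : ℝ)

/-- The projection of `ℝ^d` onto the torus `ℝ^d / ℤ^d`. -/
def toTorus {d : ℕ} (x : Fin d → ℝ) : UnitAddTorus (Fin d) := fun i => (x i : UnitAddCircle)

/-- The periodization `x ↦ Σ_k u (x + k)`. -/
def periodize {d : ℕ} (u : (Fin d → ℝ) → ℂ) (x : Fin d → ℝ) : ℂ :=
  ∑' k : Fin d → ℤ, u (x + intVec k)

lemma measurableSet_unitCube (d : ℕ) : MeasurableSet (unitCube d) :=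
  MeasurableSet.univ_pi' fun _ => measurableSet_Ioc

lemma toTorus_add_intVec {d : ℕ} (x : Fin d → ℝ) (k : Fin d → ℤ) :
    toTorus (x + intVec k) = toTorus x := by
  funext i
  simp only [toTorus, intVec, Pi.add_apply, AddCircle.coe_add]
  rw [add_eq_left]
  exact (AddCircle.coe_eq_zero_iff 1).2 ⟨k i, by simp⟩

lemma continuous_toTorus {d : ℕ} : Continuous (toTorus (d := d)) :=
  continuous_pi fun i => (AddCircle.continuous_mk' 1).comp (continuous_apply i)

lemma pairwise_disjoint_unitCube_translates (d : ℕ) :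
    Pairwise (Function.onFun Disjoint
      fun k : Fin d → ℤ => (fun x : Fin d → ℝ => x - intVec k) ⁻¹' unitCube d) := by
  intro k l hkl
  refine Set.disjoint_left.2 fun x hk hl => hkl (funext fun i => ?_)
  obtain ⟨h1, h2⟩ := hk i
  obtain ⟨h3, h4⟩ := hl i
  simp only [Pi.sub_apply, intVec] at h1 h2 h3 h4
  have h5 : k i < l i + 1 := by exact_mod_cast (by linarith : (k i : ℝ) < l i + 1)
  have h6 : l i < k i + 1 := by exact_mod_cast (by linarith : (l i : ℝ) < k i + 1)
  omega

lemma exists_sub_intVec_mem_unitCube {d : ℕ} (x : Fin d → ℝ) :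
    ∃ k : Fin d → ℤ, x - intVec k ∈ unitCube d := by
  refine ⟨fun i => ⌈x i⌉ - 1, fun i => ?_⟩
  have h1 := Int.ceil_lt_add_one (x i)
  have h2 := Int.le_ceil (x i)
  simp only [Pi.sub_apply, intVec, Int.cast_sub, Int.cast_one]
  constructor <;> linarith

lemma hasSum_setIntegral_unitCube {d : ℕ} {E : Type*} [NormedAddCommGroup E] [NormedSpace ℝ E]
    {g : (Fin d → ℝ) → E} (hg : Integrable g volume) :
    HasSum (fun k : Fin d → ℤ => ∫ x in unitCube d, g (x + intVec k)) (∫ x, g x) := by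
  have hcov : ⋃ k : Fin d → ℤ, (fun x : Fin d → ℝ => x - intVec k) ⁻¹' unitCube d = Set.univ :=
    Set.eq_univ_of_forall fun x => Set.mem_iUnion.2 (exists_sub_intVec_mem_unitCube x)
  have h := hasSum_integral_iUnion (μ := volume) (f := g)
    (fun k : Fin d → ℤ => (measurable_id.sub_const (intVec k)) (measurableSet_unitCube d))
    (pairwise_disjoint_unitCube_translates d) hg.integrableOn
  simp only [id] at h
  rw [hcov, setIntegral_univ] at h
  convert h using 1
  funext k
  rw [← (measurePreserving_add_right volume (intVec k)).setIntegral_preimage_emb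
    (measurableEmbedding_addRight _) g]
  congr 3
  ext x
  simp

lemma summable_integral_norm_translates {d : ℕ} {u : (Fin d → ℝ) → ℂ}
    (hu : Integrable u volume) :
    Summable fun k : Fin d → ℤ => ∫ x in unitCube d, ‖u (x + intVec k)‖ :=
  (hasSum_setIntegral_unitCube hu.norm).summable

lemma integrableOn_translate {d : ℕ} {u : (Fin d → ℝ) → ℂ} (hu : Integrable u volume)
    (k : Fin d → ℤ) : Integrable (fun x => u (x + intVec k)) (volume.restrict (unitCube d)) :=
  (hu.comp_add_right (intVec k)).integrableOn

lemma tsum_lintegral_enorm_translates_ne_top {d : ℕ} {u : (Fin d → ℝ) → ℂ}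
    (hu : Integrable u volume) :
    ∑' k : Fin d → ℤ, ∫⁻ x in unitCube d, ‖u (x + intVec k)‖ₑ ≠ ⊤ := by
  have h := (summable_integral_norm_translates hu).toNNReal
  have h2 : ∀ k : Fin d → ℤ, ∫⁻ x in unitCube d, ‖u (x + intVec k)‖ₑ =
      ((∫ x in unitCube d, ‖u (x + intVec k)‖).toNNReal : ℝ≥0∞) := fun k => by
    rw [← ofReal_integral_norm_eq_lintegral_enorm (integrableOn_translate hu k)]
    rfl
  simp only [h2]
  exact ENNReal.tsum_coe_ne_top_iff_summable.2 h

lemma ae_summable_translates {d : ℕ} {u : (Fin d → ℝ) → ℂ} (hu : Integrable u volume) :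
    ∀ᵐ x ∂(volume.restrict (unitCube d)), Summable fun k : Fin d → ℤ => u (x + intVec k) := by
  have := summable_norm_of_tsum_eLpNorm_ne_top le_rfl
    (fun k => (integrableOn_translate hu k).1)
    (by simpa only [eLpNorm_one_eq_lintegral_enorm] using
      tsum_lintegral_enorm_translates_ne_top hu)
  exact this.mono fun x hx => hx.of_norm

lemma integrable_periodize {d : ℕ} {u : (Fin d → ℝ) → ℂ} (hu : Integrable u volume) :
    Integrable (periodize u) (volume.restrict (unitCube d)) := by
  have hm : AEMeasurable (periodize u) (volume.restrict (unitCube d)) := by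
    refine AEMeasurable.tsum (L := .unconditional _) fun k => ?_
    exact (integrableOn_translate hu k).1.aemeasurable
  refine ⟨hm.aestronglyMeasurable, lt_of_le_of_lt ?_
    (tsum_lintegral_enorm_translates_ne_top hu).lt_top⟩
  rw [← lintegral_tsum fun k => (integrableOn_translate hu k).1.enorm]
  exact lintegral_mono fun x => enorm_tsum_le_tsum_enorm

lemma setIntegral_periodize {d : ℕ} {u : (Fin d → ℝ) → ℂ} (hu : Integrable u volume) :
    ∫ x in unitCube d, periodize u x = ∫ x, u x := by
  rw [← (hasSum_setIntegral_unitCube hu).tsum_eq]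
  exact (integral_tsum_of_summable_integral_norm (integrableOn_translate hu)
    (summable_integral_norm_translates hu)).symm

lemma setIntegral_mFourier_mul_periodize {d : ℕ} {u : (Fin d → ℝ) → ℂ}
    (hu : Integrable u volume) (n : Fin d → ℤ) :
    ∫ x in unitCube d, UnitAddTorus.mFourier n (toTorus x) * periodize u x =
      ∫ x, UnitAddTorus.mFourier n (toTorus x) * u x := by
  have hc : Continuous fun x : Fin d → ℝ => UnitAddTorus.mFourier n (toTorus x) :=
    (UnitAddTorus.mFourier n).continuous.comp continuous_toTorus
  have hi : Integrable (fun x => UnitAddTorus.mFourier n (toTorus x) * u x) volume :=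
    hu.bdd_mul (c := 1) hc.aestronglyMeasurable (Filter.Eventually.of_forall fun x =>
      ((UnitAddTorus.mFourier n).norm_coe_le_norm _).trans UnitAddTorus.mFourier_norm.le)
  rw [← setIntegral_periodize hi]
  congr 1
  funext x
  rw [periodize, periodize, ← tsum_mul_left]
  simp only [toTorus_add_intVec]

/-- The section `ℝ^d / ℤ^d → (0,1]^d` of the projection onto the torus. -/
def torusSection {d : ℕ} (t : UnitAddTorus (Fin d)) : Fin d → ℝ :=
  (UnitAddTorus.measurableEquivPiIoc (0 : Fin d → ℝ) t).1

lemma measurePreserving_torusSection (d : ℕ) :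
    MeasurePreserving (torusSection (d := d)) volume (volume.restrict (unitCube d)) := by
  have h1 := UnitAddTorus.measurePreserving_equivPiIoc (0 : Fin d → ℝ)
  have h2 := measurePreserving_subtype_coe (μa := (volume : Measure (Fin d → ℝ)))
    (measurableSet_unitCube d)
  exact h2.comp h1

lemma toTorus_torusSection {d : ℕ} (t : UnitAddTorus (Fin d)) :
    toTorus (torusSection t) = t :=
  (UnitAddTorus.measurableEquivPiIoc (0 : Fin d → ℝ)).symm_apply_apply t

lemma integral_comp_torusSection {d : ℕ} {g : (Fin d → ℝ) → ℂ}
    (hg : AEStronglyMeasurable g (volume.restrict (unitCube d))) :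
    ∫ t, g (torusSection t) = ∫ x in unitCube d, g x := by
  have h := measurePreserving_torusSection d
  rw [← h.map_eq] at hg ⊢
  rw [integral_map h.measurable.aemeasurable hg]

lemma mFourierCoeff_periodize {d : ℕ} {u : (Fin d → ℝ) → ℂ} (hu : Integrable u volume)
    (n : Fin d → ℤ) :
    UnitAddTorus.mFourierCoeff (fun t => periodize u (torusSection t)) n =
      ∫ x, UnitAddTorus.mFourier (-n) (toTorus x) * u x := by
  rw [← setIntegral_mFourier_mul_periodize hu, ← integral_comp_torusSection]
  · simp only [toTorus_torusSection]
    rfl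
  · exact ((UnitAddTorus.mFourier (-n)).continuous.comp
      continuous_toTorus).aestronglyMeasurable.mul (integrable_periodize hu).1

lemma hasSum_periodize {d : ℕ} {u v : (Fin d → ℝ) → ℂ} (hu : Integrable u volume)
    (hv : Integrable v volume) {a b : (Fin d → ℤ) → ℂ}
    (ha : ∀ n, a n = ∫ x, UnitAddTorus.mFourier n (toTorus x) * u x)
    (hb : ∀ n, b n = ∫ x, UnitAddTorus.mFourier n (toTorus x) * v x)
    (has : Summable fun n => ‖a n‖ ^ 2) (hbs : Summable fun n => ‖b n‖ ^ 2) :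
    IntegrableOn (fun x => periodize u x * (starRingEnd ℂ) (periodize v x)) (unitCube d) volume ∧
    HasSum (fun n => a n * (starRingEnd ℂ) (b n))
      (∫ x in unitCube d, periodize u x * (starRingEnd ℂ) (periodize v x)) := by
  have hmp := measurePreserving_torusSection d
  have hu' := integrable_periodize hu
  have hv' := integrable_periodize hv
  have hca : ∀ n, UnitAddTorus.mFourierCoeff (fun t => periodize u (torusSection t)) n =
      a (-n) := fun n => by rw [mFourierCoeff_periodize hu, ha]
  have hcb : ∀ n, UnitAddTorus.mFourierCoeff (fun t => periodize v (torusSection t)) n =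
      b (-n) := fun n => by rw [mFourierCoeff_periodize hv, hb]
  have hm : AEStronglyMeasurable (fun x => periodize u x * (starRingEnd ℂ) (periodize v x))
      (volume.restrict (unitCube d)) := hu'.1.mul hv'.1.star
  obtain ⟨h1, h2⟩ := hasSum_mFourierCoeff_mul_conj
    (v := fun t => periodize u (torusSection t)) (w := fun t => periodize v (torusSection t))
    (hmp.integrable_comp_of_integrable hu') (hmp.integrable_comp_of_integrable hv')
    (by
      simp only [hca]
      exact (Equiv.neg (Fin d → ℤ)).summable_iff (f := fun n => ‖a n‖ ^ 2) |>.2 has)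
    (by
      simp only [hcb]
      exact (Equiv.neg (Fin d → ℤ)).summable_iff (f := fun n => ‖b n‖ ^ 2) |>.2 hbs)
  refine ⟨(hmp.integrable_comp hm).1 h1, ?_⟩
  rw [← integral_comp_torusSection hm]
  simp only [hca, hcb] at h2
  exact (Equiv.neg _).hasSum_iff.1 h2

/-- The dilation `x ↦ |det M|⁻¹ φ ((Mᵀ)⁻¹ x)`, read on `Fin d → ℝ`. -/
def dilate {d : ℕ} (M : Matrix (Fin d) (Fin d) ℝ) (φ : Rd d → ℂ) (x : Fin d → ℝ) : ℂ :=
  ((|M.det|⁻¹ : ℝ) : ℂ) * φ (mApp (Mᵀ)⁻¹ (WithLp.toLp 2 x))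

lemma measurable_mApp_toLp {d : ℕ} (N : Matrix (Fin d) (Fin d) ℝ) :
    Measurable fun x : Fin d → ℝ => mApp N (WithLp.toLp 2 x) := by
  have h : Continuous fun x : Fin d → ℝ => N.mulVec x :=
    continuous_const.matrix_mulVec continuous_id
  exact ((EuclideanSpace.equiv (Fin d) ℝ).symm.continuous.comp h).measurable

lemma map_mApp_transpose_inv {d : ℕ} {M : Matrix (Fin d) (Fin d) ℝ} (hM : IsUnit M.det) :
    Measure.map (fun x : Fin d → ℝ => mApp (Mᵀ)⁻¹ (WithLp.toLp 2 x)) volume =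
      ENNReal.ofReal |M.det| • (volume : Measure (Rd d)) := by
  have hN : ((Mᵀ)⁻¹).det ≠ 0 := by
    rw [Matrix.det_nonsing_inv, Matrix.det_transpose, Ring.inverse_eq_inv']
    exact inv_ne_zero hM.ne_zero
  have h1 := Real.map_matrix_volume_pi_eq_smul_volume_pi hN
  have h2 := (EuclideanSpace.volume_preserving_symm_measurableEquiv_toLp (Fin d)).symm
  have h3 : (fun x : Fin d → ℝ => mApp (Mᵀ)⁻¹ (WithLp.toLp 2 x)) =
      (MeasurableEquiv.toLp 2 (Fin d → ℝ)) ∘ (Matrix.toLin' (Mᵀ)⁻¹) := rfl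
  rw [h3, ← Measure.map_map (MeasurableEquiv.toLp 2 (Fin d → ℝ)).measurable
    (LinearMap.continuous_of_finiteDimensional _).measurable, h1, Measure.map_smul]
  have h4 : Measure.map (MeasurableEquiv.toLp 2 (Fin d → ℝ)) volume =
    (volume : Measure (Rd d)) := h2.map_eq
  rw [h4, Matrix.det_nonsing_inv, Matrix.det_transpose, Ring.inverse_eq_inv', inv_inv]

lemma integrable_dilate {d : ℕ} {M : Matrix (Fin d) (Fin d) ℝ} (hM : IsUnit M.det)
    {φ : Rd d → ℂ} (hφ : Integrable φ volume) : Integrable (dilate M φ) volume := by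
  have h := hφ.smul_measure (c := ENNReal.ofReal |M.det|) ENNReal.ofReal_ne_top
  rw [← map_mApp_transpose_inv hM] at h
  exact (h.comp_measurable (measurable_mApp_toLp _)).const_mul _

lemma integral_dilate {d : ℕ} {M : Matrix (Fin d) (Fin d) ℝ} (hM : IsUnit M.det)
    {φ : Rd d → ℂ} (hφ : Integrable φ volume) : ∫ x, dilate M φ x = ∫ ξ, φ ξ := by
  have h := hφ.1.smul_measure (ENNReal.ofReal |M.det|)
  rw [← map_mApp_transpose_inv hM] at h
  have h2 := integral_map (measurable_mApp_toLp _).aemeasurable h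
  rw [map_mApp_transpose_inv hM, integral_smul_measure,
    ENNReal.toReal_ofReal (abs_nonneg _)] at h2
  unfold dilate
  rw [integral_const_mul, ← h2, Complex.real_smul, ← mul_assoc, ← Complex.ofReal_mul,
    inv_mul_cancel₀ (abs_ne_zero.2 hM.ne_zero), Complex.ofReal_one, one_mul]

lemma mFourier_toTorus {d : ℕ} (z : Fin d → ℤ) (x : Fin d → ℝ) :
    UnitAddTorus.mFourier z (toTorus x) = (Real.fourierChar (∑ i, x i * z i) : ℂ) := by
  rw [Real.fourierChar_apply, UnitAddTorus.mFourier]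
  simp only [ContinuousMap.coe_mk, toTorus, fourier_coe_apply]
  rw [← Complex.exp_sum]
  congr 1
  push_cast
  rw [Finset.mul_sum, Finset.sum_mul]
  refine Finset.sum_congr rfl fun i _ => ?_
  ring

lemma inner_mApp_transpose_inv {d : ℕ} {M : Matrix (Fin d) (Fin d) ℝ} (hM : IsUnit M.det)
    (x : Fin d → ℝ) (z : Fin d → ℤ) :
    inner ℝ (mApp (Mᵀ)⁻¹ (WithLp.toLp 2 x)) (mApp M (zv z)) = ∑ i, x i * z i := by
  have h1 : inner ℝ (mApp (Mᵀ)⁻¹ (WithLp.toLp 2 x)) (mApp M (zv z)) =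
      (((Mᵀ)⁻¹).mulVec x) ⬝ᵥ (M.mulVec fun i => (z i : ℝ)) := by
    rw [EuclideanSpace.inner_eq_star_dotProduct, dotProduct_comm]
    rfl
  have hT : IsUnit (Mᵀ).det := by rwa [Matrix.det_transpose]
  rw [h1, Matrix.dotProduct_mulVec, ← Matrix.mulVec_transpose, Matrix.mulVec_mulVec,
    Matrix.mul_nonsing_inv _ hT, Matrix.one_mulVec]
  rfl

lemma fourierInv_mApp_zv {d : ℕ} {M : Matrix (Fin d) (Fin d) ℝ} (hM : IsUnit M.det)
    {φ : Rd d → ℂ} (hφ : Integrable φ volume) (z : Fin d → ℤ) :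
    𝓕⁻ φ (mApp M (zv z)) = ∫ x, UnitAddTorus.mFourier z (toTorus x) * dilate M φ x := by
  have hi : Integrable (fun v => Real.fourierChar (inner ℝ v (mApp M (zv z))) • φ v) volume := by
    have hc : Continuous fun v : Rd d =>
        ((Real.fourierChar (inner ℝ v (mApp M (zv z))) : Circle) : ℂ) := by
      refine continuous_subtype_val.comp (Real.continuous_fourierChar.comp ?_)
      exact continuous_id.inner continuous_const
    exact hφ.bdd_mul (c := 1) hc.aestronglyMeasurable
      (Filter.Eventually.of_forall fun v => (Circle.norm_coe _).le)
  rw [Real.fourierInv_eq, ← integral_dilate hM hi]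
  congr 1
  funext x
  simp only [dilate, inner_mApp_transpose_inv hM, mFourier_toTorus, Circle.smul_def, smul_eq_mul]
  ring

lemma integrable_of_mem_Vband {d : ℕ} {F : L2 d ≃ₗᵢ[ℂ] L2 d} {E : Set (Rd d)} (hE : IsBand E)
    {f : L2 d} (hf : f ∈ Vband F E) :
    E.indicator (F f : Rd d → ℂ) =ᵐ[volume] (F f : Rd d → ℂ) ∧
      Integrable (E.indicator (F f : Rd d → ℂ)) volume := by
  constructor
  · filter_upwards [hf] with ξ hξ
    by_cases h : ξ ∈ E
    · simp [h]
    · simp [h, hξ h]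
  · rw [integrable_indicator_iff hE.1]
    have : IsFiniteMeasure (volume.restrict E) := ⟨by simpa using hE.2⟩
    exact ((Lp.memLp (F f)).restrict E).integrable one_le_two

lemma eq_fourierInv_of_isCRep {d : ℕ} {F : L2 d ≃ₗᵢ[ℂ] L2 d} (hF : IsFourier F) {f : L2 d}
    {φ : Rd d → ℂ} (hφ : φ =ᵐ[volume] (F f : Rd d → ℂ)) (hφi : Integrable φ volume)
    {f₀ : Rd d → ℂ} (hf₀ : IsCRep f f₀) : f₀ = 𝓕⁻ φ := by
  have h1 := ae_eq_fourierInv hF f (hφi.congr hφ)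
  have h2 : 𝓕⁻ φ = 𝓕⁻ (F f : Rd d → ℂ) := funext fun x => Real.fourierInv_congr_ae hφ x
  rw [h2]
  exact (Continuous.ae_eq_iff_eq volume hf₀.1 (continuous_fourierInv (hφi.congr hφ))).1
    (hf₀.2.symm.trans h1)

lemma summable_samples {d n : ℕ} {F : L2 d ≃ₗᵢ[ℂ] L2 d} {E : Set (Rd d)}
    {A : Fin n → Matrix (Fin d) (Fin d) ℝ} (h : ThetaBounded F E A fun _ => 0)
    {f : L2 d} (hf : f ∈ Vband F E) {f₀ : Rd d → ℂ} (hf₀ : IsCRep f f₀) (j : Fin n) :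
    Summable fun z : Fin d → ℤ => ‖f₀ (mApp (A j) (zv z))‖ ^ 2 := by
  obtain ⟨M, hM, h⟩ := h
  have h1 : sampleSum A (fun _ => 0) f₀ < ⊤ :=
    (h f hf f₀ hf₀).trans_lt (ENNReal.mul_lt_top hM (ENNReal.pow_lt_top ENNReal.coe_lt_top))
  have h2 := (ENNReal.le_tsum j).trans_lt h1
  simp only [add_zero, ← ENNReal.coe_pow] at h2
  simpa using NNReal.summable_coe.2 (ENNReal.tsum_coe_ne_top_iff_summable.1 h2.ne)

lemma hasSum_samples {d : ℕ} {F : L2 d ≃ₗᵢ[ℂ] L2 d} (hF : IsFourier F) {f g : L2 d}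
    {φ γ f₀ g₀ : Rd d → ℂ} (hφ : φ =ᵐ[volume] (F f : Rd d → ℂ)) (hφi : Integrable φ volume)
    (hγ : γ =ᵐ[volume] (F g : Rd d → ℂ)) (hγi : Integrable γ volume)
    (hf₀ : IsCRep f f₀) (hg₀ : IsCRep g g₀)
    {M N : Matrix (Fin d) (Fin d) ℝ} (hM : IsUnit M.det) (hN : IsUnit N.det)
    (hfs : Summable fun z : Fin d → ℤ => ‖f₀ (mApp M (zv z))‖ ^ 2)
    (hgs : Summable fun z : Fin d → ℤ => ‖g₀ (mApp N (zv z))‖ ^ 2) :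
    IntegrableOn (fun x => periodize (dilate M φ) x *
      (starRingEnd ℂ) (periodize (dilate N γ) x)) (unitCube d) volume ∧
    HasSum (fun z : Fin d → ℤ => f₀ (mApp M (zv z)) * (starRingEnd ℂ) (g₀ (mApp N (zv z))))
      (∫ x in unitCube d, periodize (dilate M φ) x *
        (starRingEnd ℂ) (periodize (dilate N γ) x)) := by
  refine hasSum_periodize (integrable_dilate hM hφi) (integrable_dilate hN hγi)
    (fun z => ?_) (fun z => ?_) hfs hgs
  · rw [eq_fourierInv_of_isCRep hF hφ hφi hf₀, fourierInv_mApp_zv hM hφi]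
  · rw [eq_fourierInv_of_isCRep hF hγ hγi hg₀, fourierInv_mApp_zv hN hγi]

/-- The multiplicity function `ξ ↦ Σ_p χ_E((Mᵀ)⁻¹(ξ + p))`. -/
def multiplicity {d : ℕ} (E : Set (Rd d)) (M : Matrix (Fin d) (Fin d) ℝ) (ξ : Rd d) : ℝ≥0∞ :=
  ∑' p : Fin d → ℤ, E.indicator (fun _ => (1 : ℝ≥0∞)) (mApp (Mᵀ)⁻¹ (ξ + zv p))

lemma multiplicity_eq_zero_iff {d : ℕ} {E : Set (Rd d)} {M : Matrix (Fin d) (Fin d) ℝ}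
    {ξ : Rd d} : multiplicity E M ξ = 0 ↔ ∀ p : Fin d → ℤ, mApp (Mᵀ)⁻¹ (ξ + zv p) ∉ E := by
  simp [multiplicity, ENNReal.tsum_eq_zero]

lemma toLp_add_intVec {d : ℕ} (x : Fin d → ℝ) (k : Fin d → ℤ) :
    (WithLp.toLp 2 (x + intVec k) : Rd d) = WithLp.toLp 2 x + zv k := rfl

lemma zv_add {d : ℕ} (k l : Fin d → ℤ) : (zv (k + l) : Rd d) = zv k + zv l := by
  ext i
  simp [zv]

lemma multiplicity_add_zv {d : ℕ} (E : Set (Rd d)) (M : Matrix (Fin d) (Fin d) ℝ)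
    (ξ : Rd d) (k : Fin d → ℤ) : multiplicity E M (ξ + zv k) = multiplicity E M ξ := by
  unfold multiplicity
  rw [← (Equiv.addLeft k).tsum_eq
    fun p => E.indicator (fun _ => (1 : ℝ≥0∞)) (mApp (Mᵀ)⁻¹ (ξ + zv p))]
  simp only [Equiv.coe_addLeft, zv_add, add_assoc]

lemma periodize_dilate_indicator_eq_zero {d : ℕ} {E : Set (Rd d)}
    {M : Matrix (Fin d) (Fin d) ℝ} {φ : Rd d → ℂ} {x : Fin d → ℝ}
    (h : multiplicity E M (WithLp.toLp 2 x) = 0) :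
    periodize (dilate M (E.indicator φ)) x = 0 := by
  rw [multiplicity_eq_zero_iff] at h
  simp only [periodize, dilate, toLp_add_intVec, Set.indicator_of_notMem (h _), mul_zero,
    tsum_zero]

lemma ae_of_ae_restrict_unitCube {d : ℕ} {p : (Fin d → ℝ) → Prop}
    (h : ∀ᵐ x ∂(volume.restrict (unitCube d)), p x)
    (hp : ∀ x (k : Fin d → ℤ), p (x - intVec k) → p x) : ∀ᵐ x ∂volume, p x := by
  rw [ae_restrict_iff' (measurableSet_unitCube d)] at h
  have h1 : ∀ᵐ x ∂(volume : Measure (Fin d → ℝ)), ∀ k : Fin d → ℤ,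
      x - intVec k ∈ unitCube d → p (x - intVec k) := ae_all_iff.2 fun k =>
    (measurePreserving_sub_right volume (intVec k)).quasiMeasurePreserving.ae h
  filter_upwards [h1] with x hx
  obtain ⟨k, hk⟩ := exists_sub_intVec_mem_unitCube x
  exact hp x k (hx k hk)

lemma ae_toLp_iff {d : ℕ} {p : Rd d → Prop} :
    (∀ᵐ x ∂(volume : Measure (Fin d → ℝ)), p (WithLp.toLp 2 x)) ↔ ∀ᵐ ξ ∂volume, p ξ := by
  have h := EuclideanSpace.volume_preserving_symm_measurableEquiv_toLp (Fin d)
  exact ⟨fun hp => h.quasiMeasurePreserving.ae hp, fun hp => h.symm.quasiMeasurePreserving.ae hp⟩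

lemma periodize_dilate_indicator_one {d : ℕ} (E : Set (Rd d)) (M : Matrix (Fin d) (Fin d) ℝ)
    (x : Fin d → ℝ) :
    periodize (dilate M (E.indicator 1)) x =
      ((∑' k : Fin d → ℤ, |M.det|⁻¹ * E.indicator (fun _ => (1 : ℝ))
        (mApp (Mᵀ)⁻¹ (WithLp.toLp 2 x + zv k)) : ℝ) : ℂ) := by
  rw [Complex.ofReal_tsum, periodize]
  refine tsum_congr fun k => ?_
  rw [dilate, toLp_add_intVec]
  by_cases h : mApp (Mᵀ)⁻¹ (WithLp.toLp 2 x + zv k) ∈ E <;> simp [h]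

lemma multiplicity_eq_zero_of_periodize {d : ℕ} {E : Set (Rd d)}
    {M : Matrix (Fin d) (Fin d) ℝ} (hM : IsUnit M.det) {x : Fin d → ℝ}
    (hs : Summable fun k : Fin d → ℤ => dilate M (E.indicator 1) (x + intVec k))
    (h : periodize (dilate M (E.indicator 1)) x = 0) :
    multiplicity E M (WithLp.toLp 2 x) = 0 := by
  have hs' : Summable fun k : Fin d → ℤ => |M.det|⁻¹ * E.indicator (fun _ => (1 : ℝ))
      (mApp (Mᵀ)⁻¹ (WithLp.toLp 2 x + zv k)) := by
    rw [← Complex.summable_ofReal]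
    refine hs.congr fun k => ?_
    rw [dilate, toLp_add_intVec]
    by_cases h : mApp (Mᵀ)⁻¹ (WithLp.toLp 2 x + zv k) ∈ E <;> simp [h]
  rw [periodize_dilate_indicator_one, Complex.ofReal_eq_zero] at h
  have h0 := (hasSum_zero_iff_of_nonneg fun k => mul_nonneg (inv_nonneg.2 (abs_nonneg _))
    (Set.indicator_nonneg (fun _ _ => zero_le_one) _)).1 (h ▸ hs'.hasSum)
  rw [multiplicity_eq_zero_iff]
  intro p hp
  have := congrFun h0 p
  simp [hp, hM.ne_zero] at this

lemma exists_mem_Vband_fourier_eq_indicator {d : ℕ} {F : L2 d ≃ₗᵢ[ℂ] L2 d} (hF : IsFourier F)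
    {E : Set (Rd d)} (hE : IsBand E) :
    Integrable (E.indicator (1 : Rd d → ℂ)) volume ∧ ∃ f ∈ Vband F E, ∃ f₀, IsCRep f f₀ ∧
      E.indicator (1 : Rd d → ℂ) =ᵐ[volume] (F f : Rd d → ℂ) := by
  have hm : MemLp (E.indicator (1 : Rd d → ℂ)) 2 volume :=
    memLp_indicator_const 2 hE.1 (1 : ℂ) (Or.inr hE.2.ne)
  have hi : Integrable (E.indicator (1 : Rd d → ℂ)) volume :=
    (integrable_indicator_iff hE.1).2 (integrableOn_const hE.2.ne)
  have he : E.indicator (1 : Rd d → ℂ) =ᵐ[volume] (F (F.symm (hm.toLp _)) : Rd d → ℂ) := by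
    rw [F.apply_symm_apply]
    exact hm.coeFn_toLp.symm
  refine ⟨hi, F.symm (hm.toLp _), ?_, 𝓕⁻ (F (F.symm (hm.toLp _)) : Rd d → ℂ),
    ⟨continuous_fourierInv (hi.congr he), ae_eq_fourierInv hF _ (hi.congr he)⟩, he⟩
  filter_upwards [he] with ξ hξ hξE
  rw [← hξ]
  simp [hξE]

lemma orth1_of_multiplicity_mul_eq_zero {d n : ℕ} {F : L2 d ≃ₗᵢ[ℂ] L2 d} (hF : IsFourier F)
    {E F' : Set (Rd d)} (hE : IsBand E) (hF' : IsBand F')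
    {A B : Fin n → Matrix (Fin d) (Fin d) ℝ}
    (hbddA : ThetaBounded F E A fun _ => 0) (hbddB : ThetaBounded F F' B fun _ => 0)
    {j : Fin n} (hA : IsUnit (A j).det) (hB : IsUnit (B j).det)
    (h : ∀ᵐ ξ ∂(volume : Measure (Rd d)), multiplicity E (A j) ξ * multiplicity F' (B j) ξ = 0) :
    Orth1 F E F' (A j) 0 (B j) 0 := by
  intro f hf g hg f₀ g₀ hf₀ hg₀
  obtain ⟨hφ, hφi⟩ := integrable_of_mem_Vband hE hf
  obtain ⟨hγ, hγi⟩ := integrable_of_mem_Vband hF' hg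
  have hs := (hasSum_samples hF hφ hφi hγ hγi hf₀ hg₀ hA hB
    (summable_samples hbddA hf hf₀ j) (summable_samples hbddB hg hg₀ j)).2.tsum_eq
  simp only [add_zero, hs]
  refine integral_eq_zero_of_ae ?_
  filter_upwards [ae_restrict_of_ae (ae_toLp_iff.2 h)] with x hx
  rcases mul_eq_zero.1 hx with hx | hx
  · simp [periodize_dilate_indicator_eq_zero hx]
  · simp [periodize_dilate_indicator_eq_zero hx]

lemma multiplicity_mul_eq_zero_of_periodize {d : ℕ} {E F' : Set (Rd d)}
    (hE : Integrable (E.indicator (1 : Rd d → ℂ)) volume)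
    (hF' : Integrable (F'.indicator (1 : Rd d → ℂ)) volume)
    {M N : Matrix (Fin d) (Fin d) ℝ} (hM : IsUnit M.det) (hN : IsUnit N.det)
    (h : ∀ᵐ x ∂(volume.restrict (unitCube d)), periodize (dilate M (E.indicator 1)) x *
      (starRingEnd ℂ) (periodize (dilate N (F'.indicator 1)) x) = 0) :
    ∀ᵐ ξ ∂(volume : Measure (Rd d)), multiplicity E M ξ * multiplicity F' N ξ = 0 := by
  rw [← ae_toLp_iff]
  refine ae_of_ae_restrict_unitCube ?_ fun x k hx => ?_
  · filter_upwards [h, ae_summable_translates (integrable_dilate hM hE),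
      ae_summable_translates (integrable_dilate hN hF')] with x hx h1 h2
    rcases mul_eq_zero.1 hx with hx | hx
    · rw [multiplicity_eq_zero_of_periodize hM h1 hx, zero_mul]
    · rw [multiplicity_eq_zero_of_periodize hN h2 ((map_eq_zero _).1 hx), mul_zero]
  · rwa [← sub_add_cancel x (intVec k), toLp_add_intVec, multiplicity_add_zv,
      multiplicity_add_zv]

lemma periodize_mul_conj_eq_norm {d : ℕ} (E F' : Set (Rd d)) (M N : Matrix (Fin d) (Fin d) ℝ)
    (x : Fin d → ℝ) :
    periodize (dilate M (E.indicator 1)) x *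
      (starRingEnd ℂ) (periodize (dilate N (F'.indicator 1)) x) =
    ((‖periodize (dilate M (E.indicator 1)) x *
      (starRingEnd ℂ) (periodize (dilate N (F'.indicator 1)) x)‖ : ℝ) : ℂ) := by
  have hpos : ∀ (G : Set (Rd d)) (L : Matrix (Fin d) (Fin d) ℝ),
      0 ≤ ∑' k : Fin d → ℤ, |L.det|⁻¹ * G.indicator (fun _ => (1 : ℝ))
        (mApp (Lᵀ)⁻¹ (WithLp.toLp 2 x + zv k)) := fun G L =>
    tsum_nonneg fun k => mul_nonneg (inv_nonneg.2 (abs_nonneg _))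
      (Set.indicator_nonneg (fun _ _ => zero_le_one) _)
  rw [periodize_dilate_indicator_one, periodize_dilate_indicator_one, Complex.conj_ofReal,
    ← Complex.ofReal_mul, Complex.norm_real, Real.norm_of_nonneg (mul_nonneg (hpos _ _) (hpos _ _))]

lemma multiplicity_mul_eq_zero_of_orth {d n : ℕ} {F : L2 d ≃ₗᵢ[ℂ] L2 d} (hF : IsFourier F)
    {E F' : Set (Rd d)} (hE : IsBand E) (hF' : IsBand F')
    {A B : Fin n → Matrix (Fin d) (Fin d) ℝ}
    (hA : ∀ j, IsUnit (A j).det) (hB : ∀ j, IsUnit (B j).det)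
    (hbddA : ThetaBounded F E A fun _ => 0) (hbddB : ThetaBounded F F' B fun _ => 0)
    (h : Orth F E F' A (fun _ => 0) B (fun _ => 0)) (j : Fin n) :
    ∀ᵐ ξ ∂(volume : Measure (Rd d)), multiplicity E (A j) ξ * multiplicity F' (B j) ξ = 0 := by
  obtain ⟨hEi, f, hf, f₀, hf₀, hφ⟩ := exists_mem_Vband_fourier_eq_indicator hF hE
  obtain ⟨hFi, g, hg, g₀, hg₀, hγ⟩ := exists_mem_Vband_fourier_eq_indicator hF hF'
  have hs := fun i => hasSum_samples hF hφ hEi hγ hFi hf₀ hg₀ (hA i) (hB i)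
    (summable_samples hbddA hf hf₀ i) (summable_samples hbddB hg hg₀ i)
  have h0 := h f hf g hg f₀ g₀ hf₀ hg₀
  simp only [add_zero, fun i => (hs i).2.tsum_eq, tsum_fintype] at h0
  have hn : ∀ i, ∫ x in unitCube d, periodize (dilate (A i) (E.indicator 1)) x *
      (starRingEnd ℂ) (periodize (dilate (B i) (F'.indicator 1)) x) =
      ((∫ x in unitCube d, ‖periodize (dilate (A i) (E.indicator 1)) x *
        (starRingEnd ℂ) (periodize (dilate (B i) (F'.indicator 1)) x)‖ : ℝ) : ℂ) := fun i =>
    (integral_congr_ae (Filter.Eventually.of_forall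
      (periodize_mul_conj_eq_norm E F' (A i) (B i)))).trans integral_complex_ofReal
  simp only [hn, ← Complex.ofReal_sum, Complex.ofReal_eq_zero] at h0
  have hj := (Finset.sum_eq_zero_iff_of_nonneg fun i _ =>
    integral_nonneg fun x => norm_nonneg _).1 h0 j (Finset.mem_univ j)
  have hz := (integral_eq_zero_iff_of_nonneg (fun x => norm_nonneg _) (hs j).1.norm).1 hj
  exact multiplicity_mul_eq_zero_of_periodize hEi hFi (hA j) (hB j)
    (hz.mono fun x hx => norm_eq_zero.1 hx)

/-- Theorem 2 of the paper. With `E`, `F'` bands and the (unshifted)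
sampling transforms of `{A_j z}` and `{B_j z}` bounded on `V_E`, `V_{F'}` respectively,
the two sample families are orthogonal on `E` and `F'` iff for each `j` one has
`(Σ_p χ_E(A_j^{*-1}(ξ+p))) (Σ_q χ_{F'}(B_j^{*-1}(ξ+q))) = 0` a.e., equivalently iff the
single-lattice samples `{A_j z}` and `{B_j z}` are orthogonal on `E` and `F'` for each `j`. -/
theorem orth_union_iff_orth_each {d n : ℕ} (hd : 1 ≤ d) (hn : 1 ≤ n)
    (F : L2 d ≃ₗᵢ[ℂ] L2 d) (hF : IsFourier F)
    (E F' : Set (Rd d)) (hE : IsBand E) (hF' : IsBand F')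
    (A B : Fin n → Matrix (Fin d) (Fin d) ℝ)
    (hA : ∀ j, IsUnit (A j).det) (hB : ∀ j, IsUnit (B j).det)
    (hbddA : ThetaBounded F E A fun _ => 0) (hbddB : ThetaBounded F F' B fun _ => 0) :
    (Orth F E F' A (fun _ => 0) B (fun _ => 0) ↔
      ∀ j : Fin n, ∀ᵐ ξ ∂(volume : Measure (Rd d)),
        (∑' p : Fin d → ℤ, E.indicator (fun _ => (1 : ℝ≥0∞)) (mApp ((A j)ᵀ)⁻¹ (ξ + zv p))) *
        (∑' q : Fin d → ℤ, F'.indicator (fun _ => (1 : ℝ≥0∞)) (mApp ((B j)ᵀ)⁻¹ (ξ + zv q)))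
          = 0) ∧
    (Orth F E F' A (fun _ => 0) B (fun _ => 0) ↔
      ∀ j : Fin n, Orth1 F E F' (A j) 0 (B j) 0) := by
  have hc : Orth F E F' A (fun _ => 0) B (fun _ => 0) →
      ∀ j : Fin n, ∀ᵐ ξ ∂(volume : Measure (Rd d)),
        multiplicity E (A j) ξ * multiplicity F' (B j) ξ = 0 :=
    multiplicity_mul_eq_zero_of_orth hF hE hF' hA hB hbddA hbddB
  have h1 : (∀ j : Fin n, ∀ᵐ ξ ∂(volume : Measure (Rd d)),
        multiplicity E (A j) ξ * multiplicity F' (B j) ξ = 0) →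
      ∀ j : Fin n, Orth1 F E F' (A j) 0 (B j) 0 := fun h j =>
    orth1_of_multiplicity_mul_eq_zero hF hE hF' hbddA hbddB (hA j) (hB j) (h j)
  have h2 : (∀ j : Fin n, Orth1 F E F' (A j) 0 (B j) 0) →
      Orth F E F' A (fun _ => 0) B (fun _ => 0) := by
    intro h f hf g hg f₀ g₀ hf₀ hg₀
    exact (tsum_congr fun j => h j f hf g hg f₀ g₀ hf₀ hg₀).trans tsum_zero
  exact ⟨⟨hc, fun h => h2 (h1 h)⟩, ⟨fun h => h1 (hc h), h2⟩⟩

end GSL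
end
end

section
/- Let G = {T_{C_p k} g_p : p ∈ P, k ∈ ℤ^d} and H = {T_{C_p k} h_p : p ∈ P, k ∈ ℤ^d} both be Bessel systems satisfying the local boundedness condition, and let Ω_{H,G} : L²(ℝ^d) → L²(ℝ^d), f ↦ Σ_{p∈P} Σ_{k∈ℤ^d} ⟨f, T_{C_p k} g_p⟩ T_{C_p k} h_p. Then Ω_{H,G} commutes with the translation operator T_y for every y ∈ ℝ^d if and only if for every α ∈ Λ \ {0}, Σ_{p∈P_α} |det C_p|^{-1} conj(ĝ_p(ξ)) ĥ_p(ξ+α) = 0 for a.e. ξ. In that case Ω_{H,G} is a Fourier multiplier with symbol s(ξ) = Σ_{p∈P} |det C_p|^{-1} conj(ĝ_p(ξ)) ĥ_p(ξ), i.e. (Ω_{H,G} f)^(ξ) = s(ξ) f̂(ξ). -/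
open MeasureTheory Complex Matrix
open scoped FourierTransform ENNReal NNReal RealInnerProductSpace Classical

noncomputable section

namespace GSL

/-- The half-open unit cell of `ℤ^d` with corner `a`. -/
def unitCell {d : ℕ} (a : Fin d → ℝ) : Set (Fin d → ℝ) :=
  {x | ∀ i, x i ∈ Set.Ioc (a i) (a i + 1)}

lemma measurableSet_unitCell {d : ℕ} (a : Fin d → ℝ) : MeasurableSet (unitCell a) :=
  MeasurableSet.univ_pi' fun _ => measurableSet_Ioc

/-- The real vector with the given integer coordinates. -/
def castVec {d : ℕ} (m : Fin d → ℤ) : Fin d → ℝ := fun i => (m i : ℝ)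

/-- The character `x ↦ exp (2πi k·x)` of `ℝ^d`. -/
def latChar {d : ℕ} (k : Fin d → ℤ) (x : Fin d → ℝ) : ℂ :=
  cexp (2 * Real.pi * I * ((∑ i, (k i : ℝ) * x i : ℝ) : ℂ))

lemma norm_latChar {d : ℕ} (k : Fin d → ℤ) (x : Fin d → ℝ) : ‖latChar k x‖ = 1 := by
  have := Complex.norm_exp_ofReal_mul_I (2 * Real.pi * ∑ i, (k i : ℝ) * x i)
  rw [← this, latChar]
  congr 2
  push_cast
  ring

lemma continuous_latChar {d : ℕ} (k : Fin d → ℤ) : Continuous (latChar k) := by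
  unfold latChar
  fun_prop

lemma latChar_add_castVec {d : ℕ} (k m : Fin d → ℤ) (x : Fin d → ℝ) :
    latChar k (x + castVec m) = latChar k x := by
  unfold latChar
  rw [Complex.exp_eq_exp_iff_exists_int]
  refine ⟨∑ i, k i * m i, ?_⟩
  simp only [castVec, Pi.add_apply, mul_add, Finset.sum_add_distrib]
  push_cast
  ring

lemma mFourier_eq_latChar {d : ℕ} (k : Fin d → ℤ) (x : Fin d → ℝ) :
    UnitAddTorus.mFourier k (fun i => (x i : UnitAddCircle)) = latChar k x := by
  simp only [UnitAddTorus.mFourier, ContinuousMap.coe_mk, latChar, fourier_coe_apply]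
  rw [← Complex.exp_sum]
  congr 1
  push_cast
  rw [Finset.mul_sum]
  refine Finset.sum_congr rfl fun i _ => ?_
  simp
  ring

lemma hasSum_integral_unitCell {d : ℕ} {f : (Fin d → ℝ) → ℂ} (hf : Integrable f volume) :
    HasSum (fun m : Fin d → ℤ => ∫ x in unitCell 0, f (x + castVec m)) (∫ x, f x) := by
  have key := hasSum_integral_iUnion (μ := (volume : Measure (Fin d → ℝ))) (f := f)
    (s := fun m : Fin d → ℤ => unitCell (castVec m)) (fun m => measurableSet_unitCell _) ?_
    hf.integrableOn
  · have hU : (⋃ m : Fin d → ℤ, unitCell (castVec m)) = Set.univ := by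
      refine Set.eq_univ_of_forall fun x => Set.mem_iUnion.2 ⟨fun i => ⌈x i⌉ - 1, fun i => ?_⟩
      simp only [castVec, Set.mem_Ioc]
      push_cast
      constructor <;> linarith [Int.ceil_lt_add_one (x i), Int.le_ceil (x i)]
    rw [hU, setIntegral_univ] at key
    refine key.congr_fun fun m => ?_
    have hp : MeasurePreserving (fun x : Fin d → ℝ => x + castVec m) volume volume :=
      measurePreserving_add_right _ _
    rw [← hp.setIntegral_preimage_emb (measurableEmbedding_addRight _) f (unitCell (castVec m))]
    congr 2
    ext x
    simp only [unitCell, castVec, Set.mem_preimage, Set.mem_ofPred_eq, Set.mem_Ioc, Pi.add_apply,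
      Pi.zero_apply]
    refine forall_congr' fun i => ?_
    constructor <;> rintro ⟨h1, h2⟩ <;> constructor <;> linarith
  · intro m n hmn
    refine Set.disjoint_left.2 fun x hx hy => hmn (funext fun i => ?_)
    obtain ⟨h1, h2⟩ := hx i
    obtain ⟨h3, h4⟩ := hy i
    simp only [castVec] at h1 h2 h3 h4
    have h5 : ((m i : ℤ) : ℝ) < n i + 1 := by linarith
    have h6 : ((n i : ℤ) : ℝ) < m i + 1 := by linarith
    norm_cast at h5 h6
    lia

lemma hasSum_parseval_unitCell {d : ℕ} {φ ψ : (Fin d → ℝ) → ℂ}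
    (hφ : MemLp φ 2 (volume.restrict (unitCell 0)))
    (hψ : MemLp ψ 2 (volume.restrict (unitCell 0))) :
    HasSum (fun k : Fin d → ℤ => (∫ x in unitCell 0, φ x * latChar k x) *
      (starRingEnd ℂ) (∫ x in unitCell 0, ψ x * latChar k x))
      (∫ x in unitCell 0, φ x * (starRingEnd ℂ) (ψ x)) := by
  let _ : MeasureSpace UnitAddCircle := ⟨AddCircle.haarAddCircle⟩
  have _ : IsProbabilityMeasure (volume : Measure UnitAddCircle) :=
    inferInstanceAs (IsProbabilityMeasure AddCircle.haarAddCircle)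
  let σ : UnitAddTorus (Fin d) → (Fin d → ℝ) :=
    fun t => (UnitAddTorus.measurableEquivPiIoc (0 : Fin d → ℝ) t).1
  have hσ : MeasurePreserving σ volume (volume.restrict (unitCell 0)) := by
    have h1 := UnitAddTorus.measurePreserving_equivPiIoc (0 : Fin d → ℝ)
    refine MeasurePreserving.comp (g := Subtype.val) ?_ h1
    exact ⟨measurable_subtype_coe, map_comap_subtype_coe (measurableSet_unitCell 0) volume⟩
  have hσx : ∀ x ∈ unitCell (0 : Fin d → ℝ), σ (fun i => (x i : UnitAddCircle)) = x := by
    intro x hx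
    have := (UnitAddTorus.measurableEquivPiIoc (0 : Fin d → ℝ)).apply_symm_apply ⟨x, hx⟩
    exact congrArg Subtype.val this
  have hmem : ∀ {χ : (Fin d → ℝ) → ℂ}, MemLp χ 2 (volume.restrict (unitCell 0)) →
      MemLp (χ ∘ σ) 2 volume := fun hχ => hχ.comp_measurePreserving hσ
  have hint : ∀ G : UnitAddTorus (Fin d) → ℂ,
      ∫ t, G t = ∫ x in unitCell 0, G (fun i => (x i : UnitAddCircle)) :=
    fun G => UnitAddTorus.integral_preimage G 0
  have hcoef : ∀ {χ : (Fin d → ℝ) → ℂ} (hχ : MemLp χ 2 (volume.restrict (unitCell 0)))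
      (k : Fin d → ℤ), UnitAddTorus.mFourierCoeff ((hmem hχ).toLp (χ ∘ σ)) (-k) =
        ∫ x in unitCell 0, χ x * latChar k x := by
    intro χ hχ k
    have h1 : UnitAddTorus.mFourierCoeff ((hmem hχ).toLp (χ ∘ σ)) (-k) =
        ∫ t, UnitAddTorus.mFourier k t * χ (σ t) := by
      unfold UnitAddTorus.mFourierCoeff
      refine integral_congr_ae ?_
      filter_upwards [(hmem hχ).coeFn_toLp] with t ht
      rw [ht, neg_neg, smul_eq_mul, Function.comp]
    rw [h1, hint]
    refine setIntegral_congr_fun (measurableSet_unitCell 0) fun x hx => ?_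
    simp only [hσx x hx, mFourier_eq_latChar, mul_comm]
  have key := UnitAddTorus.hasSum_prod_mFourierCoeff ((hmem hψ).toLp _) ((hmem hφ).toLp _)
  rw [← (Equiv.neg (Fin d → ℤ)).hasSum_iff] at key
  have hR : ∫ t, (starRingEnd ℂ) ((hmem hψ).toLp (ψ ∘ σ) t) * (hmem hφ).toLp (φ ∘ σ) t =
      ∫ x in unitCell 0, φ x * (starRingEnd ℂ) (ψ x) := by
    rw [integral_congr_ae (g := fun t => (starRingEnd ℂ) (ψ (σ t)) * φ (σ t)), hint]
    · refine setIntegral_congr_fun (measurableSet_unitCell 0) fun x hx => ?_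
      simp only [hσx x hx, mul_comm]
    · filter_upwards [(hmem hψ).coeFn_toLp, (hmem hφ).coeFn_toLp] with t h1 h2
      rw [h1, h2, Function.comp, Function.comp]
  rw [hR] at key
  convert key using 2 with k
  rw [Function.comp, Equiv.neg_apply]
  erw [hcoef hφ k, hcoef hψ k]
  rw [mul_comm]

lemma memLp_comp_add_right {d : ℕ} {φ : (Fin d → ℝ) → ℂ} (hφ : MemLp φ 2 volume)
    (v : Fin d → ℝ) : MemLp (fun x => φ (x + v)) 2 volume :=
  hφ.comp_measurePreserving (measurePreserving_add_right volume v)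

/-- Parseval's identity for the periodizations of two `L²` functions of bounded support. -/
lemma exists_hasSum_parseval {d : ℕ} {φ ψ : (Fin d → ℝ) → ℂ} (hφ : MemLp φ 2 volume)
    (hψ : MemLp ψ 2 volume) {R : ℝ} (hφR : ∀ x, R < ‖x‖ → φ x = 0)
    (hψR : ∀ x, R < ‖x‖ → ψ x = 0) :
    ∃ s : ℂ, HasSum (fun k : Fin d → ℤ => (∫ x, φ x * latChar k x) *
        (starRingEnd ℂ) (∫ x, ψ x * latChar k x)) s ∧
      HasSum (fun m : Fin d → ℤ => ∫ x, φ x * (starRingEnd ℂ) (ψ (x + castVec m))) s := by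
  obtain ⟨N, hN⟩ := exists_nat_ge (R + 1)
  let S : Finset (Fin d → ℤ) := Finset.Icc (fun _ => -(N : ℤ)) (fun _ => (N : ℤ))
  have hS : ∀ x ∈ unitCell (0 : Fin d → ℝ), ∀ m ∉ S, R < ‖x + castVec m‖ := by
    intro x hx m hm
    by_contra! hle
    refine hm (Finset.mem_Icc.2 ⟨fun i => ?_, fun i => ?_⟩)
    all_goals
      have h1 := (norm_le_pi_norm (x + castVec m) i).trans hle
      obtain ⟨h2, h3⟩ := hx i
      rw [Real.norm_eq_abs, abs_le] at h1
      simp only [Pi.add_apply, castVec, Pi.zero_apply] at h1 h2 h3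
      have h4 : -(N : ℝ) ≤ m i ∧ (m i : ℝ) ≤ N := ⟨by linarith, by linarith⟩
      norm_cast at h4
      simp only [h4.1, h4.2]
  have hloc : ∀ {χ : (Fin d → ℝ) → ℂ} (hχ : MemLp χ 2 volume) (v : Fin d → ℝ),
      MemLp (fun x => χ (x + v)) 2 (volume.restrict (unitCell 0)) :=
    fun hχ v => (memLp_comp_add_right hχ v).restrict _
  have hfold : ∀ {χ : (Fin d → ℝ) → ℂ}, Integrable χ volume → (∀ x, R < ‖x‖ → χ x = 0) →
      ∫ x, χ x = ∑ m ∈ S, ∫ x in unitCell 0, χ (x + castVec m) := by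
    intro χ hχ hχR
    refine (hasSum_integral_unitCell hχ).unique (hasSum_sum_of_ne_finset_zero fun m hm => ?_)
    refine setIntegral_eq_zero_of_forall_eq_zero fun x hx => hχR _ (hS x hx m hm)
  have hint : ∀ {χ : (Fin d → ℝ) → ℂ}, MemLp χ 2 volume → (∀ x, R < ‖x‖ → χ x = 0) →
      Integrable χ volume := by
    intro χ hχ hχR
    have : IntegrableOn χ (Metric.closedBall 0 R) volume := by
      have _ : IsFiniteMeasure (volume.restrict (Metric.closedBall (0 : Fin d → ℝ) R)) :=
        ⟨by simpa using measure_closedBall_lt_top⟩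
      exact (hχ.restrict _).integrable (by norm_num)
    refine (integrableOn_iff_integrable_of_support_subset fun x hx => ?_).1 this
    by_contra h
    exact hx (hχR x (by simpa using h))
  let Φ : (Fin d → ℝ) → ℂ := fun x => ∑ m ∈ S, φ (x + castVec m)
  let Ψ : (Fin d → ℝ) → ℂ := fun x => ∑ m ∈ S, ψ (x + castVec m)
  have hΦ : MemLp Φ 2 (volume.restrict (unitCell 0)) :=
    memLp_finsetSum S fun m _ => hloc hφ _
  have hΨ : MemLp Ψ 2 (volume.restrict (unitCell 0)) :=
    memLp_finsetSum S fun m _ => hloc hψ _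
  have hcell : ∀ {f : (Fin d → ℝ) → ℂ}, MemLp f 2 (volume.restrict (unitCell 0)) →
      Integrable f (volume.restrict (unitCell 0)) := by
    intro f hf
    have _ : IsFiniteMeasure (volume.restrict (unitCell (0 : Fin d → ℝ))) := by
      refine ⟨?_⟩
      have : unitCell (0 : Fin d → ℝ) ⊆ Metric.closedBall 0 1 := fun x hx => by
        rw [mem_closedBall_zero_iff, pi_norm_le_iff_of_nonneg zero_le_one]
        intro i
        obtain ⟨h1, h2⟩ := hx i
        rw [Real.norm_eq_abs, abs_le]
        simp only [Pi.zero_apply] at h1 h2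
        constructor <;> linarith
      simpa using (measure_mono this).trans_lt measure_closedBall_lt_top
    exact hf.integrable (by norm_num)
  have hmulchar : ∀ {χ : (Fin d → ℝ) → ℂ} {μ : Measure (Fin d → ℝ)} (k : Fin d → ℤ),
      MemLp χ 2 μ → MemLp (fun x => χ x * latChar k x) 2 μ := by
    intro χ μ k hχ
    refine hχ.mono (hχ.1.mul (continuous_latChar k).aestronglyMeasurable) (ae_of_all _ fun x => ?_)
    rw [norm_mul, norm_latChar, mul_one]
  have hcoef : ∀ {χ : (Fin d → ℝ) → ℂ}, MemLp χ 2 volume → (∀ x, R < ‖x‖ → χ x = 0) →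
      ∀ k : Fin d → ℤ, ∫ x, χ x * latChar k x =
        ∫ x in unitCell 0, (∑ m ∈ S, χ (x + castVec m)) * latChar k x := by
    intro χ hχ hχR k
    have h0 : ∀ x, R < ‖x‖ → χ x * latChar k x = 0 := fun x hx => by rw [hχR x hx, zero_mul]
    rw [hfold (hint (hmulchar k hχ) h0) h0]
    simp only [latChar_add_castVec, Finset.sum_mul]
    exact (integral_finsetSum S fun m _ => hcell (hmulchar k (hloc hχ _))).symm
  refine ⟨∫ x in unitCell 0, Φ x * (starRingEnd ℂ) (Ψ x), ?_, ?_⟩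
  · simp only [hcoef hφ hφR, hcoef hψ hψR]
    exact hasSum_parseval_unitCell hΦ hΨ
  have hprod : ∀ v w : Fin d → ℝ, Integrable
      (fun x => φ (x + v) * (starRingEnd ℂ) (ψ (x + w))) volume := fun v w =>
    (memLp_comp_add_right hφ v).integrable_mul (memLp_comp_add_right hψ w).star
  have h1 : ∀ m : Fin d → ℤ, ∫ x, φ x * (starRingEnd ℂ) (ψ (x + castVec m)) =
      ∑ n ∈ S, ∫ x in unitCell 0, φ (x + castVec n) *
        (starRingEnd ℂ) (ψ (x + castVec (n + m))) := by
    intro m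
    rw [hfold (by simpa using hprod 0 (castVec m)) fun x hx => by rw [hφR x hx, zero_mul]]
    refine Finset.sum_congr rfl fun n _ => ?_
    have : castVec n + castVec m = castVec (n + m) := by ext; simp [castVec]
    simp only [add_assoc, this]
  have h2 : ∫ x in unitCell 0, Φ x * (starRingEnd ℂ) (Ψ x) =
      ∑ n ∈ S, ∑ m ∈ S, ∫ x in unitCell 0, φ (x + castVec n) *
        (starRingEnd ℂ) (ψ (x + castVec m)) := by
    simp only [Φ, Ψ, map_sum, Finset.sum_mul_sum]
    rw [integral_finsetSum S fun n _ => integrable_finsetSum S fun m _ =>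
      (hprod _ _).integrableOn]
    exact Finset.sum_congr rfl fun n _ => integral_finsetSum S fun m _ => (hprod _ _).integrableOn
  simp only [h1, h2]
  refine hasSum_sum fun n _ => ?_
  rw [← (Equiv.addLeft (-n)).hasSum_iff]
  simp only [Function.comp_def, Equiv.coe_addLeft, add_neg_cancel_left]
  refine hasSum_sum_of_ne_finset_zero fun m hm => ?_
  refine setIntegral_eq_zero_of_forall_eq_zero fun x hx => ?_
  rw [hψR _ (hS x hx m hm), map_zero, mul_zero]

/-- The character `ξ ↦ exp (2πi ⟨y, ξ⟩)` of `ℝ^d`. -/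
def phase {d : ℕ} (y ξ : Rd d) : ℂ := cexp (2 * Real.pi * I * ((⟪y, ξ⟫ : ℝ) : ℂ))

lemma norm_phase {d : ℕ} (y ξ : Rd d) : ‖phase y ξ‖ = 1 := by
  have := Complex.norm_exp_ofReal_mul_I (2 * Real.pi * ⟪y, ξ⟫)
  rw [← this, phase]
  congr 2
  push_cast
  ring

lemma continuous_phase {d : ℕ} (y : Rd d) : Continuous (phase y) := by
  unfold phase
  fun_prop

lemma phase_add_right {d : ℕ} (y ξ η : Rd d) : phase y (ξ + η) = phase y ξ * phase y η := by
  simp only [phase, inner_add_right, ofReal_add, mul_add, Complex.exp_add]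

lemma conj_phase {d : ℕ} (y ξ : Rd d) : (starRingEnd ℂ) (phase y ξ) = phase (-y) ξ := by
  simp only [phase, ← Complex.exp_conj, inner_neg_left]
  congr 1
  simp only [map_mul, conj_ofReal, conj_I, map_ofNat]
  push_cast
  ring

lemma phase_mul_phase_neg {d : ℕ} (y ξ : Rd d) : phase y ξ * phase (-y) ξ = 1 := by
  rw [phase, phase, ← Complex.exp_add, inner_neg_left]
  simp

lemma memLp_phase_mul {d : ℕ} (y : Rd d) (f : L2 d) :
    MemLp (fun ξ => phase y ξ * (f : Rd d → ℂ) ξ) 2 volume := by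
  refine (Lp.memLp f).mono ((continuous_phase y).aestronglyMeasurable.mul (Lp.memLp f).1)
    (ae_of_all _ fun ξ => ?_)
  rw [norm_mul, norm_phase, one_mul]

/-- Multiplication by a character on `L²`. -/
def phaseMul {d : ℕ} (y : Rd d) (f : L2 d) : L2 d := (memLp_phase_mul y f).toLp _

lemma coeFn_phaseMul {d : ℕ} (y : Rd d) (f : L2 d) :
    (phaseMul y f : Rd d → ℂ) =ᵐ[volume] fun ξ => phase y ξ * (f : Rd d → ℂ) ξ :=
  MemLp.coeFn_toLp _

lemma isometry_phaseMul {d : ℕ} (y : Rd d) : Isometry (phaseMul y : L2 d → L2 d) := by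
  refine Isometry.of_dist_eq fun f g => ?_
  rw [Lp.dist_def, Lp.dist_def]
  congr 1
  refine eLpNorm_congr_norm_ae ?_
  filter_upwards [coeFn_phaseMul y f, coeFn_phaseMul y g] with ξ h1 h2
  rw [Pi.sub_apply, Pi.sub_apply, h1, h2, ← mul_sub, norm_mul, norm_phase, one_mul]

lemma IsTrans.eq_compMeasurePreserving {d : ℕ} {T : Rd d → L2 d → L2 d} (hT : IsTrans T)
    (y : Rd d) (f : L2 d) :
    T y f = Lp.compMeasurePreserving (fun x => x + -y)
      (measurePreserving_add_right volume (-y)) f := by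
  refine Lp.ext ((hT y f).trans ?_)
  filter_upwards [Lp.coeFn_compMeasurePreserving f
    (measurePreserving_add_right (volume : Measure (Rd d)) (-y))] with x hx
  rw [hx, Function.comp, sub_eq_add_neg]

lemma IsTrans.isometry {d : ℕ} {T : Rd d → L2 d → L2 d} (hT : IsTrans T) (y : Rd d) :
    Isometry (T y) := by
  have : T y = Lp.compMeasurePreserving (fun x => x + -y)
      (measurePreserving_add_right volume (-y)) := funext (hT.eq_compMeasurePreserving y)
  rw [this]
  exact Lp.isometry_compMeasurePreserving _

/-- The Fourier transform turns translations into multiplications by characters. -/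
lemma IsFourier.map_trans {d : ℕ} {F : L2 d ≃ₗᵢ[ℂ] L2 d} (hF : IsFourier F)
    {T : Rd d → L2 d → L2 d} (hT : IsTrans T) (y : Rd d) (f : L2 d) :
    F (T y f) = phaseMul (-y) (F f) := by
  have key : (fun f => F (T y f)) = fun f => phaseMul (-y) (F f) := by
    refine (SchwartzMap.denseRange_toLpCLM (E := Rd d) (F := ℂ) (p := 2) (μ := volume)
      (by norm_num)).equalizer (F.continuous.comp (hT.isometry y).continuous)
      ((isometry_phaseMul (-y)).continuous.comp F.continuous) (funext fun u => ?_)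
    simp only [Function.comp]
    set v : L2 d := SchwartzMap.toLpCLM ℝ ℂ 2 volume u
    have hv : Integrable (v : Rd d → ℂ) volume :=
      u.integrable.congr (SchwartzMap.coeFn_toLp u 2 volume).symm
    have hTv : Integrable (T y v : Rd d → ℂ) volume :=
      (hv.comp_sub_right y).congr (hT y v).symm
    refine Lp.ext ?_
    filter_upwards [hF _ hTv, hF _ hv, coeFn_phaseMul (-y) (F v)] with ξ h1 h2 h3
    rw [h1, h3, h2, Real.fourier_congr_ae (hT y v)]
    have := congrFun (VectorFourier.fourierIntegral_comp_add_right Real.fourierChar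
      (volume : Measure (Rd d)) (innerₗ (Rd d)) (v : Rd d → ℂ) (-y)) ξ
    refine Eq.trans ?_ (this.trans ?_)
    · simp only [sub_eq_add_neg]
      rfl
    · rw [Circle.smul_def, Real.fourierChar_apply, smul_eq_mul, phase]
      congr 2
      simp only [innerₗ_apply_apply]
      push_cast
      ring
  exact congrFun key f

lemma pair_eq_inner {d : ℕ} {T : Rd d → L2 d → L2 d} (hT : IsTrans T) (f g : L2 d) (y : Rd d) :
    pair f g y = inner ℂ (T y g) f := by
  rw [L2.inner_def, pair]
  refine integral_congr_ae ?_
  filter_upwards [hT y g] with x hx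
  rw [hx, RCLike.inner_apply]

lemma inner_trans_eq {d : ℕ} {F : L2 d ≃ₗᵢ[ℂ] L2 d} (hF : IsFourier F)
    {T : Rd d → L2 d → L2 d} (hT : IsTrans T) (f g : L2 d) (y : Rd d) :
    inner ℂ (T y g) f = ∫ ξ, ((F f : Rd d → ℂ) ξ * (starRingEnd ℂ) ((F g : Rd d → ℂ) ξ)) *
      phase y ξ := by
  rw [← F.inner_map_map, hF.map_trans hT, L2.inner_def]
  refine integral_congr_ae ?_
  filter_upwards [coeFn_phaseMul (-y) (F g)] with ξ h1
  rw [h1, RCLike.inner_apply, map_mul, conj_phase, neg_neg]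
  ring

lemma integral_gaussian_mul_phase {d : ℕ} {b : ℝ} (hb : 0 < b) (γ : Rd d) :
    ∫ y : Rd d, cexp (-b * (‖y‖ : ℂ) ^ 2) * phase y γ =
      (∫ y : Rd d, cexp (-b * (‖y‖ : ℂ) ^ 2)) * cexp (((-(Real.pi ^ 2 * ‖γ‖ ^ 2 / b) : ℝ) : ℂ)) := by
  have h1 := GaussianFourier.integral_cexp_neg_mul_sq_norm_add (V := Rd d) (b := b)
    (by simpa using hb) (2 * Real.pi * I) γ
  have h2 := GaussianFourier.integral_cexp_neg_mul_sq_norm (V := Rd d) (b := b) (by simpa using hb)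
  have hb' : (b : ℂ) ≠ 0 := by exact_mod_cast hb.ne'
  rw [h2]
  refine Eq.trans (integral_congr_ae (ae_of_all _ fun y => ?_)) (h1.trans ?_)
  · simp only [phase]
    rw [← Complex.exp_add, real_inner_comm]
  · congr 2
    push_cast
    field_simp
    rw [I_sq]
    ring

/-- The coefficients of an absolutely convergent exponential series with constant sum vanish at
every nonzero frequency. -/
lemma tsum_coeff_eq_zero {d : ℕ} {ι : Type*} [Countable ι] {a : ι → ℂ} (ha : Summable a)
    (α : ι → Rd d) {c : ℂ} (hc : ∀ y : Rd d, ∑' i, a i * phase y (α i) = c) {β : Rd d}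
    (hβ : β ≠ 0) : ∑' i, (if α i = β then a i else 0) = 0 := by
  have hexp : ∀ γ : Rd d, Filter.Tendsto (fun n : ℕ => cexp
      (((-(Real.pi ^ 2 * ‖γ‖ ^ 2 / ((n : ℝ) + 1)⁻¹) : ℝ) : ℂ))) Filter.atTop
      (nhds (if γ = 0 then 1 else 0)) := by
    intro γ
    split_ifs with hγ
    · simp [hγ]
    · have hpos : 0 < Real.pi ^ 2 * ‖γ‖ ^ 2 := by positivity
      have h1 : Filter.Tendsto (fun n : ℕ => Real.exp
          (-(Real.pi ^ 2 * ‖γ‖ ^ 2 / ((n : ℝ) + 1)⁻¹))) Filter.atTop (nhds 0) := by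
        refine Real.tendsto_exp_neg_atTop_nhds_zero.comp ?_
        simp only [div_inv_eq_mul]
        exact (Filter.tendsto_atTop_add_const_right _ _ tendsto_natCast_atTop_atTop).const_mul_atTop
          hpos
      have h2 := (Complex.continuous_ofReal.tendsto 0).comp h1
      simpa only [Function.comp_def, Complex.ofReal_exp, Complex.ofReal_zero] using h2
  have havg : ∀ b : ℝ, 0 < b →
      ∑' i, a i * cexp (((-(Real.pi ^ 2 * ‖α i - β‖ ^ 2 / b) : ℝ) : ℂ)) =
        c * cexp (((-(Real.pi ^ 2 * ‖-β‖ ^ 2 / b) : ℝ) : ℂ)) := by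
    intro b hb
    have hgi : Integrable (fun y : Rd d => cexp (-b * (‖y‖ : ℂ) ^ 2)) volume := by
      simpa using GaussianFourier.integrable_cexp_neg_mul_sq_norm_add (V := Rd d) (b := b)
        (by simpa using hb) 0 0
    have hg0 : (∫ y : Rd d, cexp (-b * (‖y‖ : ℂ) ^ 2)) ≠ 0 := by
      rw [GaussianFourier.integral_cexp_neg_mul_sq_norm (V := Rd d) (b := b) (by simpa using hb)]
      have h0 : (Real.pi / b : ℂ) ≠ 0 := by
        have : (b : ℂ) ≠ 0 := by exact_mod_cast hb.ne'
        exact div_ne_zero (by exact_mod_cast Real.pi_ne_zero) this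
      simp [Complex.cpow_eq_zero_iff, h0]
    have hcont : ∀ γ : Rd d, Continuous fun y : Rd d => phase y γ := fun γ => by
      unfold phase
      fun_prop
    have hgp : ∀ γ : Rd d, Integrable
        (fun y : Rd d => cexp (-b * (‖y‖ : ℂ) ^ 2) * phase y γ) volume := fun γ =>
      hgi.mul_bdd (c := 1) (hcont γ).aestronglyMeasurable
        (ae_of_all _ fun y => (norm_phase y γ).le)
    have hsum := hasSum_integral_of_summable_integral_norm
      (F := fun i (y : Rd d) => a i * (cexp (-b * (‖y‖ : ℂ) ^ 2) * phase y (α i - β)))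
      (fun i => (hgp _).const_mul _) (by
        simp only [norm_mul, norm_phase, mul_one, integral_const_mul]
        exact ha.norm.mul_right _)
    have h1 : ∀ y : Rd d, ∑' i, a i * (cexp (-b * (‖y‖ : ℂ) ^ 2) * phase y (α i - β)) =
        c * (cexp (-b * (‖y‖ : ℂ) ^ 2) * phase y (-β)) := by
      intro y
      rw [← hc y, ← tsum_mul_right]
      refine tsum_congr fun i => ?_
      rw [sub_eq_add_neg, phase_add_right]
      ring
    have h2 := hsum.tsum_eq
    simp only [h1, integral_const_mul, integral_gaussian_mul_phase hb] at h2
    refine mul_left_cancel₀ hg0 ?_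
    rw [← tsum_mul_left]
    refine Eq.trans (tsum_congr fun i => ?_) (h2.trans ?_) <;> ring
  have hL : Filter.Tendsto (fun n : ℕ => ∑' i, a i * cexp
      (((-(Real.pi ^ 2 * ‖α i - β‖ ^ 2 / ((n : ℝ) + 1)⁻¹) : ℝ) : ℂ))) Filter.atTop
      (nhds (∑' i, (if α i = β then a i else 0))) := by
    refine tendsto_tsum_of_dominated_convergence ha.norm (fun i => ?_)
      (Filter.Eventually.of_forall fun n i => ?_)
    · have := (hexp (α i - β)).const_mul (a i)
      simpa only [sub_eq_zero, mul_ite, mul_one, mul_zero] using this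
    · rw [norm_mul, Complex.norm_exp_ofReal]
      refine mul_le_of_le_one_right (norm_nonneg _) (Real.exp_le_one_iff.2 ?_)
      rw [neg_nonpos]
      positivity
  refine tendsto_nhds_unique hL ?_
  simp only [havg _ (Nat.inv_pos_of_nat)]
  simpa [hβ] using (hexp (-β)).const_mul c

/-- The linear parametrization `η ↦ (C^*)⁻¹ η` of `ℝ^d` by lattice coordinates. -/
def dualEquiv {d : ℕ} (C : Matrix (Fin d) (Fin d) ℝ) (hC : IsUnit C.det) :
    (Fin d → ℝ) ≃L[ℝ] Rd d :=
  (Matrix.toLinearEquiv' (Cᵀ)⁻¹ (invertibleOfIsUnitDet _ (by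
    rwa [isUnit_nonsing_inv_det_iff, det_transpose]))).toContinuousLinearEquiv.trans
      (EuclideanSpace.equiv (Fin d) ℝ).symm

lemma dualEquiv_apply {d : ℕ} {C : Matrix (Fin d) (Fin d) ℝ} (hC : IsUnit C.det)
    (η : Fin d → ℝ) : dualEquiv C hC η = WithLp.toLp 2 ((Cᵀ)⁻¹.mulVec η) := rfl

lemma dualEquiv_castVec {d : ℕ} {C : Matrix (Fin d) (Fin d) ℝ} (hC : IsUnit C.det)
    (m : Fin d → ℤ) : dualEquiv C hC (castVec m) = mApp (Cᵀ)⁻¹ (zv m) := rfl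

lemma map_dualEquiv_volume {d : ℕ} {C : Matrix (Fin d) (Fin d) ℝ} (hC : IsUnit C.det) :
    Measure.map (dualEquiv C hC) volume = ENNReal.ofReal |C.det| • volume := by
  have h1 : ((Cᵀ)⁻¹).det ≠ 0 := by
    rw [det_nonsing_inv, det_transpose]
    exact hC.ringInverse.ne_zero
  have h2 := Real.map_matrix_volume_pi_eq_smul_volume_pi h1
  have h3 : (dualEquiv C hC : (Fin d → ℝ) → Rd d) =
      WithLp.toLp 2 ∘ Matrix.toLin' (Cᵀ)⁻¹ := rfl
  have hm := PiLp.volume_preserving_toLp (Fin d)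
  rw [h3, ← Measure.map_map hm.measurable
    (LinearMap.continuous_of_finiteDimensional _).measurable, h2, Measure.map_smul, hm.map_eq,
    det_nonsing_inv, det_transpose, Ring.inverse_eq_inv, inv_inv]

lemma integral_comp_dualEquiv {d : ℕ} {C : Matrix (Fin d) (Fin d) ℝ} (hC : IsUnit C.det)
    (f : Rd d → ℂ) :
    ∫ η, f (dualEquiv C hC η) = ((|C.det| : ℝ) : ℂ) * ∫ ξ, f ξ := by
  have h := (dualEquiv C hC).toHomeomorph.measurableEmbedding.integral_map (μ := volume) f
  simp only [ContinuousLinearEquiv.coe_toHomeomorph] at h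
  rw [← h, map_dualEquiv_volume hC, integral_smul_measure, ENNReal.toReal_ofReal (abs_nonneg _),
    Complex.real_smul]

lemma MemLp.comp_dualEquiv {d : ℕ} {C : Matrix (Fin d) (Fin d) ℝ} (hC : IsUnit C.det)
    {f : Rd d → ℂ} (hf : MemLp f 2 volume) : MemLp (f ∘ dualEquiv C hC) 2 volume := by
  refine MemLp.comp_of_map ?_ (dualEquiv C hC).continuous.aemeasurable
  rw [map_dualEquiv_volume hC]
  exact hf.smul_measure ENNReal.ofReal_ne_top

lemma phase_dualEquiv {d : ℕ} {C : Matrix (Fin d) (Fin d) ℝ} (hC : IsUnit C.det)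
    (k : Fin d → ℤ) (η : Fin d → ℝ) :
    phase (mApp C (zv k)) (dualEquiv C hC η) = latChar k η := by
  have h : (⟪mApp C (zv k), dualEquiv C hC η⟫ : ℝ) = ∑ i, (k i : ℝ) * η i := by
    rw [EuclideanSpace.inner_eq_star_dotProduct, dualEquiv_apply]
    have h1 : (mApp C (zv k)).ofLp = C.mulVec (castVec k) := rfl
    have hCt : IsUnit (Cᵀ).det := by rwa [det_transpose]
    rw [h1, star_trivial, dotProduct_mulVec, ← mulVec_transpose, mulVec_mulVec,
      mul_nonsing_inv _ hCt, one_mulVec, dotProduct]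
    exact Finset.sum_congr rfl fun i _ => mul_comm _ _
  rw [phase, h, latChar]

/-- Parseval's identity for the lattice `C ℤ^d` and its dual lattice. -/
lemma exists_hasSum_parseval_lattice {d : ℕ} {C : Matrix (Fin d) (Fin d) ℝ} (hC : IsUnit C.det)
    {φ ψ : Rd d → ℂ} (hφ : MemLp φ 2 volume) (hψ : MemLp ψ 2 volume) {R : ℝ}
    (hφR : ∀ x, R < ‖x‖ → φ x = 0) (hψR : ∀ x, R < ‖x‖ → ψ x = 0) :
    ∃ s : ℂ, HasSum (fun k : Fin d → ℤ => (∫ ξ, φ ξ * phase (mApp C (zv k)) ξ) *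
        (starRingEnd ℂ) (∫ ξ, ψ ξ * phase (mApp C (zv k)) ξ)) s ∧
      HasSum (fun m : Fin d → ℤ => ((|C.det|⁻¹ : ℝ) : ℂ) *
        ∫ ξ, φ ξ * (starRingEnd ℂ) (ψ (ξ + mApp (Cᵀ)⁻¹ (zv m)))) s := by
  have hbd : ∀ η, ‖((dualEquiv C hC).symm : Rd d →L[ℝ] (Fin d → ℝ))‖ * R < ‖η‖ →
      R < ‖dualEquiv C hC η‖ := by
    intro η hη
    by_contra! hle
    have h1 := ((dualEquiv C hC).symm : Rd d →L[ℝ] (Fin d → ℝ)).le_opNorm (dualEquiv C hC η)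
    have h2 := mul_le_mul_of_nonneg_left hle
      (norm_nonneg ((dualEquiv C hC).symm : Rd d →L[ℝ] (Fin d → ℝ)))
    simp only [ContinuousLinearEquiv.coe_coe, ContinuousLinearEquiv.symm_apply_apply] at h1
    linarith
  obtain ⟨s, h1, h2⟩ := exists_hasSum_parseval (MemLp.comp_dualEquiv hC hφ)
    (MemLp.comp_dualEquiv hC hψ) (fun η hη => hφR _ (hbd η hη)) (fun η hη => hψR _ (hbd η hη))
  have hdet : ((|C.det| : ℝ) : ℂ) ≠ 0 := by
    exact_mod_cast abs_ne_zero.2 hC.ne_zero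
  have hcoef : ∀ (χ : Rd d → ℂ) (k : Fin d → ℤ), ∫ η, (χ ∘ dualEquiv C hC) η * latChar k η =
      ((|C.det| : ℝ) : ℂ) * ∫ ξ, χ ξ * phase (mApp C (zv k)) ξ := by
    intro χ k
    rw [← integral_comp_dualEquiv hC]
    simp only [phase_dualEquiv, Function.comp]
  have hcorr : ∀ m : Fin d → ℤ, ∫ η, (φ ∘ dualEquiv C hC) η *
      (starRingEnd ℂ) ((ψ ∘ dualEquiv C hC) (η + castVec m)) = ((|C.det| : ℝ) : ℂ) *
        ∫ ξ, φ ξ * (starRingEnd ℂ) (ψ (ξ + mApp (Cᵀ)⁻¹ (zv m))) := by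
    intro m
    rw [← integral_comp_dualEquiv hC]
    simp only [← dualEquiv_castVec hC, ← map_add, Function.comp]
  simp only [hcoef] at h1
  simp only [hcorr] at h2
  refine ⟨((|C.det| : ℝ) : ℂ)⁻¹ ^ 2 * s, (h1.mul_left _).congr_fun fun k => ?_,
    (h2.mul_left _).congr_fun fun m => ?_⟩
  · rw [map_mul, conj_ofReal]
    field_simp
  · push_cast
    field_simp

lemma integrable_tsum_of_tsum_lintegral {X ι : Type*} [MeasurableSpace X] [Countable ι]
    {μ : Measure X} {G : ι → X → ℂ} (hm : ∀ i, AEStronglyMeasurable (G i) μ)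
    (hG : ∑' i, ∫⁻ x, ‖G i x‖ₑ ∂μ ≠ ⊤) : Integrable (fun x => ∑' i, G i x) μ := by
  have hl : ∫⁻ x, ∑' i, ‖G i x‖ₑ ∂μ = ∑' i, ∫⁻ x, ‖G i x‖ₑ ∂μ :=
    lintegral_tsum fun i => (hm i).enorm
  have hfin : ∀ᵐ x ∂μ, ∑' i, ‖G i x‖ₑ < ⊤ :=
    ae_lt_top' (AEMeasurable.tsum fun i => (hm i).enorm) (hl ▸ hG)
  have hs : ∀ᵐ x ∂μ, Summable fun i => G i x := by
    filter_upwards [hfin] with x hx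
    exact Summable.of_enorm hx.ne
  refine ⟨?_, ?_⟩
  · refine aestronglyMeasurable_of_tendsto_ae (Filter.atTop : Filter (Finset ι))
      (f := fun s x => ∑ i ∈ s, G i x) (fun s => ?_) ?_
    · exact Finset.aestronglyMeasurable_fun_sum s fun i _ => hm i
    · filter_upwards [hs] with x hx using hx.hasSum
  · refine lt_of_le_of_lt (lintegral_mono_ae (g := fun x => ∑' i, ‖G i x‖ₑ) ?_) (hl ▸ hG.lt_top)
    filter_upwards with x
    exact enorm_tsum_le_tsum_enorm

lemma summable_integral_of_tsum_lintegral {X ι : Type*} [MeasurableSpace X]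
    {μ : Measure X} {G : ι → X → ℂ}
    (hG : ∑' i, ∫⁻ x, ‖G i x‖ₑ ∂μ ≠ ⊤) : Summable fun i => ∫ x, G i x ∂μ :=
  Summable.of_enorm (ne_top_of_le_ne_top hG
    (ENNReal.tsum_le_tsum fun _ => enorm_integral_le_lintegral_enorm _))

/-- Essentially bounded functions whose essential support is bounded. -/
structure BddCompactSupp {d : ℕ} (φ : Rd d → ℂ) : Prop where
  aesm : AEStronglyMeasurable φ volume
  bdd : ∃ M : ℝ, ∀ᵐ ξ, ‖φ ξ‖ ≤ M
  supp : ∃ R : ℝ, ∀ᵐ ξ, φ ξ ≠ 0 → ‖ξ‖ ≤ R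

namespace BddCompactSupp

variable {d : ℕ} {φ ψ : Rd d → ℂ}

lemma congr (hφ : BddCompactSupp φ) (h : φ =ᵐ[volume] ψ) : BddCompactSupp ψ where
  aesm := hφ.aesm.congr h
  bdd := by
    obtain ⟨M, hM⟩ := hφ.bdd
    refine ⟨M, ?_⟩
    filter_upwards [hM, h] with ξ h1 h2
    rwa [← h2]
  supp := by
    obtain ⟨R, hR⟩ := hφ.supp
    refine ⟨R, ?_⟩
    filter_upwards [hR, h] with ξ h1 h2
    rwa [← h2]

lemma indicator (hφ : BddCompactSupp φ) {A : Set (Rd d)} (hA : MeasurableSet A) :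
    BddCompactSupp (A.indicator φ) where
  aesm := hφ.aesm.indicator hA
  bdd := by
    obtain ⟨M, hM⟩ := hφ.bdd
    refine ⟨M, ?_⟩
    filter_upwards [hM] with ξ h1
    exact (norm_indicator_le_norm_self _ _).trans h1
  supp := by
    obtain ⟨R, hR⟩ := hφ.supp
    refine ⟨R, ?_⟩
    filter_upwards [hR] with ξ h1 h2
    exact h1 fun h3 => h2 (by simp [Set.indicator_apply, h3])

lemma indicator_closedBall (R : ℝ) :
    BddCompactSupp ((Metric.closedBall (0 : Rd d) R).indicator fun _ => (1 : ℂ)) where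
  aesm := aestronglyMeasurable_const.indicator measurableSet_closedBall
  bdd := ⟨1, Filter.Eventually.of_forall fun ξ =>
    (norm_indicator_le_norm_self _ _).trans (by simp)⟩
  supp := ⟨R, Filter.Eventually.of_forall fun ξ h => by
    have := Set.mem_of_indicator_ne_zero h
    simpa using this⟩

lemma exists_bound (hφ : BddCompactSupp φ) :
    ∃ M R : ℝ, 0 ≤ M ∧ ∀ᵐ ξ, ‖φ ξ‖ ≤ M ∧ (φ ξ ≠ 0 → ‖ξ‖ ≤ R) := by
  obtain ⟨M, hM⟩ := hφ.bdd
  obtain ⟨R, hR⟩ := hφ.supp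
  refine ⟨max M 0, R, le_max_right _ _, ?_⟩
  filter_upwards [hM, hR] with ξ h1 h2 using ⟨h1.trans (le_max_left _ _), h2⟩

lemma memLp (hφ : BddCompactSupp φ) (p : ℝ≥0∞) : MemLp φ p volume := by
  obtain ⟨M, R, hM0, hMR⟩ := hφ.exists_bound
  refine (((memLp_indicator_const p measurableSet_closedBall M
    (Or.inr (isCompact_closedBall (0 : Rd d) R).measure_lt_top.ne))).of_le hφ.aesm ?_)
  filter_upwards [hMR] with ξ h
  by_cases h0 : φ ξ = 0
  · simp [h0]
  · rw [Set.indicator_of_mem (by simpa using h.2 h0)]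
    exact h.1.trans (le_abs_self _)

end BddCompactSupp

lemma ae_comp_add_right {d : ℕ} {p : Rd d → Prop} (h : ∀ᵐ ξ, p ξ) (a : Rd d) :
    ∀ᵐ ξ, p (ξ + a) :=
  (measurePreserving_add_right volume a).quasiMeasurePreserving.ae h

lemma aesm_comp_add_right {d : ℕ} {φ : Rd d → ℂ} (h : AEStronglyMeasurable φ volume) (a : Rd d) :
    AEStronglyMeasurable (fun ξ => φ (ξ + a)) volume :=
  h.comp_measurePreserving (measurePreserving_add_right volume a)

lemma measurableSet_norm_le_and {d : ℕ} (R : ℝ) (a : Rd d) :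
    MeasurableSet {ξ : Rd d | ‖ξ‖ ≤ R ∧ ‖ξ + a‖ ≤ R} := by
  have h1 : MeasurableSet {ξ : Rd d | ‖ξ‖ ≤ R} := measurableSet_le (by fun_prop) (by fun_prop)
  have h2 : MeasurableSet {ξ : Rd d | ‖ξ + a‖ ≤ R} := measurableSet_le (by fun_prop) (by fun_prop)
  exact h1.inter h2

/-- A family of kernels which is absolutely summable, locally in `ξ` and `ξ + α i`. -/
structure LocSummable {d : ℕ} {ι : Type*} (α : ι → Rd d) (K : ι → Rd d → ℂ) : Prop where
  aesm : ∀ i, AEStronglyMeasurable (K i) volume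
  fin : ∀ R : ℝ, ∑' i, ∫⁻ ξ in {ξ | ‖ξ‖ ≤ R ∧ ‖ξ + α i‖ ≤ R}, ‖K i ξ‖ₑ ≠ ⊤

/-- The integrand `φ(ξ) conj(ψ(ξ + a)) k(ξ)`. -/
def crossTerm {d : ℕ} (φ ψ : Rd d → ℂ) (a : Rd d) (k : Rd d → ℂ) (ξ : Rd d) : ℂ :=
  φ ξ * (starRingEnd ℂ) (ψ (ξ + a)) * k ξ

lemma aesm_crossTerm {d : ℕ} {φ ψ k : Rd d → ℂ} (hφ : AEStronglyMeasurable φ volume)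
    (hψ : AEStronglyMeasurable ψ volume) (hk : AEStronglyMeasurable k volume) (a : Rd d) :
    AEStronglyMeasurable (crossTerm φ ψ a k) volume :=
  (hφ.mul (RCLike.continuous_conj.comp_aestronglyMeasurable (aesm_comp_add_right hψ a))).mul hk

/-- The part `∑_{α i = β} K i` of a family of kernels. -/
def fiberSum {d : ℕ} {ι : Type*} (α : ι → Rd d) (K : ι → Rd d → ℂ) (β ξ : Rd d) : ℂ :=
  ∑' i, if α i = β then K i ξ else 0

namespace LocSummable

variable {d : ℕ} {ι : Type*} {α : ι → Rd d} {K : ι → Rd d → ℂ} {φ ψ : Rd d → ℂ}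

lemma tsum_lintegral_crossTerm_ne_top (hK : LocSummable α K) (hφ : BddCompactSupp φ)
    (hψ : BddCompactSupp ψ) : ∑' i, ∫⁻ ξ, ‖crossTerm φ ψ (α i) (K i) ξ‖ₑ ≠ ⊤ := by
  obtain ⟨M, R, hM, h1⟩ := hφ.exists_bound
  obtain ⟨M', R', hM', h2⟩ := hψ.exists_bound
  have key : ∀ i, ∫⁻ ξ, ‖crossTerm φ ψ (α i) (K i) ξ‖ₑ ≤ ENNReal.ofReal (M * M') *
      ∫⁻ ξ in {ξ | ‖ξ‖ ≤ max R R' ∧ ‖ξ + α i‖ ≤ max R R'}, ‖K i ξ‖ₑ := by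
    intro i
    rw [← lintegral_const_mul' _ _ ENNReal.ofReal_ne_top,
      ← lintegral_indicator (measurableSet_norm_le_and _ _)]
    refine lintegral_mono_ae ?_
    filter_upwards [h1, ae_comp_add_right h2 (α i)] with ξ h3 h4
    by_cases h0 : crossTerm φ ψ (α i) (K i) ξ = 0
    · simp [h0]
    · have h0' : crossTerm φ ψ (α i) (K i) ξ ≠ 0 := h0
      rw [crossTerm, mul_ne_zero_iff, mul_ne_zero_iff] at h0'
      rw [Set.indicator_of_mem]
      · rw [crossTerm, enorm_mul]
        gcongr
        rw [← ofReal_norm, norm_mul, RCLike.norm_conj]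
        exact ENNReal.ofReal_le_ofReal (mul_le_mul h3.1 h4.1 (norm_nonneg _) hM)
      · refine ⟨(h3.2 h0'.1.1).trans (le_max_left _ _), (h4.2 ?_).trans (le_max_right _ _)⟩
        intro h5
        exact h0'.1.2 (by rw [h5, map_zero])
  refine ne_top_of_le_ne_top ?_ (ENNReal.tsum_le_tsum key)
  rw [ENNReal.tsum_mul_left]
  exact ENNReal.mul_ne_top ENNReal.ofReal_ne_top (hK.fin _)

lemma summable_integral_crossTerm (hK : LocSummable α K) (hφ : BddCompactSupp φ)
    (hψ : BddCompactSupp ψ) : Summable fun i => ∫ ξ, crossTerm φ ψ (α i) (K i) ξ :=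
  summable_integral_of_tsum_lintegral (hK.tsum_lintegral_crossTerm_ne_top hφ hψ)

lemma crossTerm_fiberSum (β ξ : Rd d) : crossTerm φ ψ β (fiberSum α K β) ξ =
    ∑' i, if α i = β then crossTerm φ ψ (α i) (K i) ξ else 0 := by
  rw [crossTerm, fiberSum, ← tsum_mul_left]
  refine tsum_congr fun i => ?_
  split_ifs with h
  · rw [crossTerm, h]
  · rw [mul_zero]

lemma integrable_crossTerm_fiberSum [Countable ι] (hK : LocSummable α K) (hφ : BddCompactSupp φ)
    (hψ : BddCompactSupp ψ) (β : Rd d) :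
    Integrable (crossTerm φ ψ β (fiberSum α K β)) volume ∧
      ∑' i, (if α i = β then ∫ ξ, crossTerm φ ψ (α i) (K i) ξ else 0) =
        ∫ ξ, crossTerm φ ψ β (fiberSum α K β) ξ := by
  have hfin : ∑' i, ∫⁻ ξ, ‖if α i = β then crossTerm φ ψ (α i) (K i) ξ else 0‖ₑ ≠ ⊤ := by
    refine ne_top_of_le_ne_top (hK.tsum_lintegral_crossTerm_ne_top hφ hψ)
      (ENNReal.tsum_le_tsum fun i => lintegral_mono fun ξ => ?_)
    split_ifs <;> simp
  have hm : ∀ i, AEStronglyMeasurable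
      (fun ξ => if α i = β then crossTerm φ ψ (α i) (K i) ξ else 0) volume := by
    intro i
    split_ifs
    · exact aesm_crossTerm hφ.aesm hψ.aesm (hK.aesm i) _
    · exact aestronglyMeasurable_const
  have he : crossTerm φ ψ β (fiberSum α K β) =
      fun ξ => ∑' i, if α i = β then crossTerm φ ψ (α i) (K i) ξ else 0 :=
    funext fun ξ => crossTerm_fiberSum β ξ
  refine ⟨he ▸ integrable_tsum_of_tsum_lintegral hm hfin, ?_⟩
  rw [he, integral_tsum hm hfin]
  refine tsum_congr fun i => ?_
  split_ifs <;> simp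

lemma fiberSum_ae_eq_zero [Countable ι] (hK : LocSummable α K) (β : Rd d)
    (h0 : ∀ φ ψ : Rd d → ℂ, BddCompactSupp φ → BddCompactSupp ψ →
      ∑' i, (if α i = β then ∫ ξ, crossTerm φ ψ (α i) (K i) ξ else 0) = 0) :
    ∀ᵐ ξ, fiberSum α K β ξ = 0 := by
  have key : ∀ n : ℕ, ∀ᵐ ξ : Rd d, ‖ξ‖ ≤ n → ‖ξ + β‖ ≤ n → fiberSum α K β ξ = 0 := by
    intro n
    have hb := BddCompactSupp.indicator_closedBall (d := d) n
    have h1 := (hK.integrable_crossTerm_fiberSum hb hb β).1.ae_eq_zero_of_forall_setIntegral_eq_zero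
      fun A hA _ => by
        rw [← integral_indicator hA, ← h0 _ _ (hb.indicator hA) hb,
          (hK.integrable_crossTerm_fiberSum (hb.indicator hA) hb β).2]
        refine integral_congr_ae (Filter.Eventually.of_forall fun ξ => ?_)
        by_cases hξ : ξ ∈ A <;> simp [crossTerm, hξ]
    filter_upwards [h1] with ξ h2 h3 h4
    have h5 : ξ ∈ Metric.closedBall (0 : Rd d) n := by simpa using h3
    have h6 : ξ + β ∈ Metric.closedBall (0 : Rd d) n := by simpa using h4
    simpa [crossTerm, h5, h6] using h2
  filter_upwards [ae_all_iff.2 key] with ξ h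
  obtain ⟨n, hn⟩ := exists_nat_ge (max ‖ξ‖ ‖ξ + β‖)
  exact h n ((le_max_left _ _).trans hn) ((le_max_right _ _).trans hn)

lemma tsum_integral_eq_of_fiberSum_eq_zero [Countable ι] (hK : LocSummable α K)
    (h0 : ∀ β, β ≠ 0 → ∀ᵐ ξ, fiberSum α K β ξ = 0)
    (hφ : BddCompactSupp φ) (hψ : BddCompactSupp ψ) :
    ∑' i, ∫ ξ, crossTerm φ ψ (α i) (K i) ξ = ∫ ξ, crossTerm φ ψ 0 (fiberSum α K 0) ξ := by
  have h1 := (hK.summable_integral_crossTerm hφ hψ).hasSum.tsum_fiberwise α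
  have h2 : ∀ β, ∑' i : α ⁻¹' {β}, ∫ ξ, crossTerm φ ψ (α i) (K i) ξ =
      ∫ ξ, crossTerm φ ψ β (fiberSum α K β) ξ := by
    intro β
    rw [← (hK.integrable_crossTerm_fiberSum hφ hψ β).2,
      tsum_subtype (α ⁻¹' {β}) fun i => ∫ ξ, crossTerm φ ψ (α i) (K i) ξ]
    refine tsum_congr fun i => ?_
    simp [Set.indicator_apply]
  simp only [h2] at h1
  refine h1.unique (hasSum_single 0 fun β hβ => ?_)
  refine integral_eq_zero_of_ae ?_
  filter_upwards [h0 β hβ] with ξ hξ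
  simp [crossTerm, hξ]

end LocSummable

lemma exists_fourier_eq {d : ℕ} (F : L2 d ≃ₗᵢ[ℂ] L2 d) {φ : Rd d → ℂ} (hφ : BddCompactSupp φ) :
    ∃ f : L2 d, (F f : Rd d → ℂ) =ᵐ[volume] φ :=
  ⟨F.symm ((hφ.memLp 2).toLp φ), by
    rw [LinearIsometryEquiv.apply_symm_apply]
    exact MemLp.coeFn_toLp _⟩

lemma BddCompactSupp.memD {d : ℕ} {F : L2 d ≃ₗᵢ[ℂ] L2 d} {f : L2 d}
    (hf : BddCompactSupp (F f : Rd d → ℂ)) : MemD F f := ⟨hf.bdd, hf.supp⟩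

/-- The frequency `C_p^{*-1} k` attached to the index `(p, k)`. -/
def freq {d : ℕ} {P : Type*} (C : P → Matrix (Fin d) (Fin d) ℝ) (i : P × (Fin d → ℤ)) : Rd d :=
  mApp ((C i.1)ᵀ)⁻¹ (zv i.2)

/-- The kernel `|det C_p|⁻¹ conj(ĝ_p(ξ)) ĥ_p(ξ + C_p^{*-1} k)`. -/
def omegaKer {d : ℕ} {P : Type*} (F : L2 d ≃ₗᵢ[ℂ] L2 d) (C : P → Matrix (Fin d) (Fin d) ℝ)
    (g h : P → L2 d) (i : P × (Fin d → ℤ)) (ξ : Rd d) : ℂ :=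
  ((|(C i.1).det|⁻¹ : ℝ) : ℂ) * (starRingEnd ℂ) ((F (g i.1) : Rd d → ℂ) ξ) *
    (F (h i.1) : Rd d → ℂ) (ξ + freq C i)

section Kernel

variable {d : ℕ} {P : Type*} {F : L2 d ≃ₗᵢ[ℂ] L2 d} {C : P → Matrix (Fin d) (Fin d) ℝ}
  {g h : P → L2 d}

lemma zv_neg (k : Fin d → ℤ) : zv (-k) = -zv k := by
  ext i
  simp [zv]

lemma zv_injective : Function.Injective (zv : (Fin d → ℤ) → Rd d) := by
  intro k l hkl
  ext i
  have := congrArg (fun x : Rd d => x i) hkl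
  simpa [zv] using this

lemma mApp_neg (A : Matrix (Fin d) (Fin d) ℝ) (x : Rd d) : mApp A (-x) = -mApp A x := by
  simp only [mApp, map_neg, mulVec_neg]

lemma mApp_mApp (A B : Matrix (Fin d) (Fin d) ℝ) (x : Rd d) :
    mApp A (mApp B x) = mApp (A * B) x := by
  simp only [mApp, ContinuousLinearEquiv.apply_symm_apply, mulVec_mulVec]

lemma mApp_one (x : Rd d) : mApp 1 x = x := by
  simp only [mApp, one_mulVec, ContinuousLinearEquiv.symm_apply_apply]

lemma mApp_zero (A : Matrix (Fin d) (Fin d) ℝ) : mApp A 0 = 0 := by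
  simp only [mApp, map_zero, mulVec_zero]

lemma mApp_transpose_inv {A : Matrix (Fin d) (Fin d) ℝ} (hA : IsUnit A.det) (x : Rd d) :
    mApp Aᵀ (mApp (Aᵀ)⁻¹ x) = x := by
  rw [mApp_mApp, mul_nonsing_inv _ (by rwa [det_transpose]), mApp_one]

lemma mApp_inv_transpose {A : Matrix (Fin d) (Fin d) ℝ} (hA : IsUnit A.det) (x : Rd d) :
    mApp (Aᵀ)⁻¹ (mApp Aᵀ x) = x := by
  rw [mApp_mApp, nonsing_inv_mul _ (by rwa [det_transpose]), mApp_one]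

lemma freq_neg (p : P) (k : Fin d → ℤ) : freq C (p, -k) = -freq C (p, k) := by
  simp only [freq, zv_neg, mApp_neg]

lemma LocBound.tsum_lintegral_ne_top (hl : LocBound F C g) (R : ℝ) :
    ∑' i : P × (Fin d → ℤ), ∫⁻ ξ in {ξ | ‖ξ‖ ≤ R ∧ ‖ξ + freq C i‖ ≤ R},
      ENNReal.ofReal |(C i.1).det|⁻¹ * ‖(F (g i.1) : Rd d → ℂ) ξ‖ₑ ^ 2 ≠ ⊤ := by
  have hb := BddCompactSupp.indicator_closedBall (d := d) R
  obtain ⟨f, hf⟩ := exists_fourier_eq F hb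
  refine ne_top_of_le_ne_top (hl f (hb.congr hf.symm).memD).ne ?_
  rw [ENNReal.tsum_prod']
  refine ENNReal.tsum_le_tsum fun p => ENNReal.tsum_le_tsum fun k => ?_
  have hm : MeasurableSet {ξ : Rd d | (F f : Rd d → ℂ) ξ ≠ 0} :=
    (Lp.stronglyMeasurable _).measurable (measurableSet_singleton (0 : ℂ)).compl
  rw [← lintegral_indicator (measurableSet_norm_le_and _ _), ← lintegral_indicator hm]
  refine lintegral_mono_ae ?_
  filter_upwards [hf, ae_comp_add_right hf (freq C (p, k))] with ξ h1 h2
  by_cases h3 : ξ ∈ {ξ | ‖ξ‖ ≤ R ∧ ‖ξ + freq C (p, k)‖ ≤ R}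
  · have h4 : ξ ∈ Metric.closedBall (0 : Rd d) R := by simpa using h3.1
    have h5 : ξ + freq C (p, k) ∈ Metric.closedBall (0 : Rd d) R := by simpa using h3.2
    rw [Set.indicator_of_mem h4] at h1
    rw [Set.indicator_of_mem h5] at h2
    rw [Set.indicator_of_mem h3, Set.indicator_of_mem (show (F f : Rd d → ℂ) ξ ≠ 0 by simp [h1])]
    change _ ≤ (‖(F f : Rd d → ℂ) (ξ + freq C (p, k))‖₊ : ℝ≥0∞) ^ 2 * _ * _
    rw [h2]
    simp [enorm_eq_nnnorm]
  · rw [Set.indicator_of_notMem h3]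
    exact zero_le

lemma LocBound.tsum_lintegral_shift_ne_top (hl : LocBound F C h) (R : ℝ) :
    ∑' i : P × (Fin d → ℤ), ∫⁻ ξ in {ξ | ‖ξ‖ ≤ R ∧ ‖ξ + freq C i‖ ≤ R},
      ENNReal.ofReal |(C i.1).det|⁻¹ * ‖(F (h i.1) : Rd d → ℂ) (ξ + freq C i)‖ₑ ^ 2 ≠ ⊤ := by
  have h1 := hl.tsum_lintegral_ne_top R
  rw [← ((Equiv.refl P).prodCongr (Equiv.neg (Fin d → ℤ))).tsum_eq] at h1
  refine ne_of_eq_of_ne (tsum_congr fun i => ?_) h1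
  obtain ⟨p, k⟩ := i
  simp only [Equiv.prodCongr_apply, Prod.map_apply, Equiv.refl_apply, Equiv.neg_apply, freq_neg]
  rw [← lintegral_indicator (measurableSet_norm_le_and _ _),
    ← lintegral_indicator (measurableSet_norm_le_and _ _), eq_comm,
    ← lintegral_add_right_eq_self _ (freq C (p, k))]
  refine lintegral_congr fun ξ => ?_
  simp [Set.indicator_apply, and_comm]

lemma locSummable_omegaKer (hg : LocBound F C g) (hh : LocBound F C h) :
    LocSummable (freq C) (omegaKer F C g h) where
  aesm i := (aestronglyMeasurable_const.mul
    (RCLike.continuous_conj.comp_aestronglyMeasurable (Lp.aestronglyMeasurable _))).mul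
      (aesm_comp_add_right (Lp.aestronglyMeasurable _) _)
  fin R := by
    refine ne_top_of_le_ne_top (ENNReal.add_ne_top.2
      ⟨hg.tsum_lintegral_ne_top R, hh.tsum_lintegral_shift_ne_top R⟩) ?_
    rw [← ENNReal.tsum_add]
    refine ENNReal.tsum_le_tsum fun i => ?_
    rw [← lintegral_add_left']
    · refine lintegral_mono fun ξ => ?_
      have hxy : ∀ x y : ℝ≥0∞, x * y ≤ x ^ 2 + y ^ 2 := by
        intro x y
        rcases le_total x y with hle | hle
        · calc x * y ≤ y * y := by gcongr
            _ = y ^ 2 := (sq y).symm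
            _ ≤ _ := le_add_self
        · calc x * y ≤ x * x := by gcongr
            _ = x ^ 2 := (sq x).symm
            _ ≤ _ := le_self_add
      rw [omegaKer, enorm_mul, enorm_mul, mul_assoc, ← mul_add]
      have h1 : ‖((|(C i.1).det|⁻¹ : ℝ) : ℂ)‖ₑ = ENNReal.ofReal |(C i.1).det|⁻¹ := by
        rw [← ofReal_norm, Complex.norm_real, Real.norm_of_nonneg (by positivity)]
      rw [h1]
      gcongr
      refine le_trans (le_of_eq ?_) (hxy _ _)
      rw [← ofReal_norm, RCLike.norm_conj, ofReal_norm]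
    · exact (((Lp.aestronglyMeasurable (F (g i.1))).enorm.pow_const 2).const_mul _).restrict

lemma fiberSum_omegaKer (hC : ∀ p, IsUnit (C p).det) (β ξ : Rd d) :
    fiberSum (freq C) (omegaKer F C g h) β ξ = alphaSum F C g h β ξ := by
  let e : {p // memPalpha C β p} → P × (Fin d → ℤ) := fun p => (p.1, p.2.choose)
  have he : ∀ p, freq C (e p) = β := by
    intro p
    change mApp ((C p.1)ᵀ)⁻¹ (zv p.2.choose) = β
    rw [← p.2.choose_spec, mApp_inv_transpose (hC p.1)]
  have hinj : Function.Injective e := fun p q hpq => Subtype.ext (congrArg Prod.fst hpq)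
  rw [fiberSum, alphaSum, ← hinj.tsum_eq]
  · refine tsum_congr fun p => ?_
    rw [if_pos (he p), omegaKer, he p]
  · intro i hi
    have h1 : freq C i = β := by
      by_contra hne
      exact hi (if_neg hne)
    have h2 : mApp (C i.1)ᵀ β = zv i.2 := by
      rw [← h1, freq, mApp_transpose_inv (hC i.1)]
    have hp : memPalpha C β i.1 := ⟨i.2, h2⟩
    refine ⟨⟨i.1, hp⟩, Prod.ext rfl (zv_injective ?_)⟩
    exact hp.choose_spec.symm.trans h2

lemma alphaSum_eq_zero_of_not_memLambda (hC : ∀ p, IsUnit (C p).det) {β : Rd d}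
    (hβ : ¬ memLambda C β) (ξ : Rd d) : alphaSum F C g h β ξ = 0 := by
  have : IsEmpty {p // memPalpha C β p} := ⟨fun p => hβ ⟨p.1, p.2.choose, by
    rw [← p.2.choose_spec, mApp_inv_transpose (hC p.1)]⟩⟩
  exact tsum_empty

lemma alphaSum_zero (ξ : Rd d) : alphaSum F C g h 0 ξ =
    ∑' p : P, ((|(C p).det|⁻¹ : ℝ) : ℂ) * (starRingEnd ℂ) ((F (g p) : Rd d → ℂ) ξ) *
      (F (h p) : Rd d → ℂ) ξ := by
  have h0 : ∀ p, memPalpha C 0 p := fun p => ⟨0, by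
    rw [mApp_zero]
    ext i
    simp [zv]⟩
  rw [← (Equiv.subtypeUnivEquiv h0).tsum_eq, alphaSum]
  simp only [add_zero, Equiv.subtypeUnivEquiv_apply]

end Kernel

section Operator

variable {d : ℕ} {P : Type*} {F : L2 d ≃ₗᵢ[ℂ] L2 d} {C : P → Matrix (Fin d) (Fin d) ℝ}
  {g h : P → L2 d} {T : Rd d → L2 d → L2 d} {Ω : L2 d → L2 d}

lemma memLp_mul_conj {φ : Rd d → ℂ} (hφ : BddCompactSupp φ) (v : L2 d) :
    MemLp (fun ξ => φ ξ * (starRingEnd ℂ) ((v : Rd d → ℂ) ξ)) 2 volume := by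
  obtain ⟨M, hM⟩ := hφ.bdd
  refine (Lp.memLp v).of_le_mul (c := M) (hφ.aesm.mul
    (RCLike.continuous_conj.comp_aestronglyMeasurable (Lp.aestronglyMeasurable v))) ?_
  filter_upwards [hM] with ξ h1
  rw [norm_mul, RCLike.norm_conj]
  gcongr

lemma exists_eq_indicator_closedBall {φ : Rd d → ℂ} (hφ : BddCompactSupp φ) :
    ∃ R₀ : ℝ, ∀ R, R₀ ≤ R → φ =ᵐ[volume] (Metric.closedBall (0 : Rd d) R).indicator φ := by
  obtain ⟨R₀, hR⟩ := hφ.supp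
  refine ⟨R₀, fun R hle => ?_⟩
  filter_upwards [hR] with ξ h1
  by_cases h2 : φ ξ = 0
  · simp [Set.indicator_apply, h2]
  · rw [Set.indicator_of_mem (by simpa using (h1 h2).trans hle)]

lemma inner_omega [Countable P] (hF : IsFourier F) (hC : ∀ p, IsUnit (C p).det)
    (hK : LocSummable (freq C) (omegaKer F C g h)) (hT : IsTrans T) (hΩ : IsOmega T C C g h Ω)
    {f u : L2 d} (hf : BddCompactSupp (F f : Rd d → ℂ)) (hu : BddCompactSupp (F u : Rd d → ℂ)) :
    inner ℂ u (Ω f) = ∑' i, ∫ ξ, crossTerm (F f) (F u) (freq C i) (omegaKer F C g h i) ξ := by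
  have h1 := (hΩ f).mapL (innerSL ℂ u)
  have h2 := (hK.summable_integral_crossTerm hf hu).hasSum
  obtain ⟨R₁, hR₁⟩ := exists_eq_indicator_closedBall hf
  obtain ⟨R₂, hR₂⟩ := exists_eq_indicator_closedBall hu
  let R := max R₁ R₂
  let B := Metric.closedBall (0 : Rd d) R
  have hB : MeasurableSet B := measurableSet_closedBall
  have e1 := hR₁ R (le_max_left _ _)
  have e2 := hR₂ R (le_max_right _ _)
  have hz : ∀ (φ : Rd d → ℂ) (v : L2 d) (x : Rd d), R < ‖x‖ →
      B.indicator φ x * (starRingEnd ℂ) ((v : Rd d → ℂ) x) = 0 := by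
    intro φ v x hx
    rw [Set.indicator_of_notMem (by simpa [B] using hx), zero_mul]
  have key : ∀ p, ∃ s, HasSum (fun k => innerSL ℂ u
        (pair f (g p) (mApp (C p) (zv k)) • T (mApp (C p) (zv k)) (h p))) s ∧
      HasSum (fun k => ∫ ξ, crossTerm (F f) (F u) (freq C (p, k)) (omegaKer F C g h (p, k)) ξ) s := by
    intro p
    obtain ⟨s, hs1, hs2⟩ := exists_hasSum_parseval_lattice (hC p)
      (memLp_mul_conj (hf.indicator hB) (F (g p))) (memLp_mul_conj (hu.indicator hB) (F (h p)))
      (hz _ _) (hz _ _)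
    refine ⟨s, hs1.congr_fun fun k => ?_, hs2.congr_fun fun k => ?_⟩
    · rw [innerSL_apply_apply, inner_smul_right, pair_eq_inner hT, ← inner_conj_symm u,
        inner_trans_eq hF hT, inner_trans_eq hF hT]
      congr 1
      · refine integral_congr_ae ?_
        filter_upwards [e1] with ξ h3
        rw [← h3]
      · congr 1
        refine integral_congr_ae ?_
        filter_upwards [e2] with ξ h3
        rw [← h3]
    · rw [← integral_const_mul]
      refine integral_congr_ae ?_
      filter_upwards [e1, ae_comp_add_right e2 (freq C (p, k))] with ξ h3 h4
      change crossTerm _ _ _ _ _ = _ * (_ * (starRingEnd ℂ)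
        (B.indicator _ (ξ + freq C (p, k)) *
          (starRingEnd ℂ) ((F (h p) : Rd d → ℂ) (ξ + freq C (p, k)))))
      rw [← h3, ← h4, crossTerm, omegaKer, map_mul, Complex.conj_conj]
      ring
  choose s hs1 hs2 using key
  exact (h1.prod_fiberwise hs1).unique (h2.prod_fiberwise hs2)

lemma inner_trans_trans (hF : IsFourier F) (hT : IsTrans T) (y : Rd d) (u v : L2 d) :
    inner ℂ (T y u) (T y v) = inner ℂ u v := by
  rw [← F.inner_map_map (T y u), ← F.inner_map_map u, hF.map_trans hT, hF.map_trans hT,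
    L2.inner_def, L2.inner_def]
  refine integral_congr_ae ?_
  filter_upwards [coeFn_phaseMul (-y) (F u), coeFn_phaseMul (-y) (F v)] with ξ h1 h2
  rw [h1, h2, RCLike.inner_apply, RCLike.inner_apply, map_mul, conj_phase]
  have := phase_mul_phase_neg (-y) ξ
  linear_combination (F v : Rd d → ℂ) ξ * (starRingEnd ℂ) ((F u : Rd d → ℂ) ξ) * this

lemma bddCompactSupp_trans (hF : IsFourier F) (hT : IsTrans T) (y : Rd d) {f : L2 d}
    (hf : BddCompactSupp (F f : Rd d → ℂ)) : BddCompactSupp (F (T y f) : Rd d → ℂ) := by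
  have h0 := coeFn_phaseMul (-y) (F f)
  rw [← hF.map_trans hT] at h0
  refine BddCompactSupp.congr
    ⟨(continuous_phase (-y)).aestronglyMeasurable.mul hf.aesm, ?_, ?_⟩ h0.symm
  · obtain ⟨M, hM⟩ := hf.bdd
    refine ⟨M, ?_⟩
    filter_upwards [hM] with ξ h1
    change ‖phase (-y) ξ * (F f : Rd d → ℂ) ξ‖ ≤ M
    rwa [norm_mul, norm_phase, one_mul]
  · obtain ⟨R, hR⟩ := hf.supp
    refine ⟨R, ?_⟩
    filter_upwards [hR] with ξ h1 h2
    exact h1 (right_ne_zero_of_mul h2)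

lemma integral_crossTerm_trans (hF : IsFourier F) (hT : IsTrans T) (y : Rd d) (f u : L2 d)
    (a : Rd d) (k : Rd d → ℂ) :
    ∫ ξ, crossTerm (F (T y f)) (F (T y u)) a k ξ =
      (∫ ξ, crossTerm (F f) (F u) a k ξ) * phase y a := by
  rw [← integral_mul_const, hF.map_trans hT, hF.map_trans hT]
  refine integral_congr_ae ?_
  filter_upwards [coeFn_phaseMul (-y) (F f),
    ae_comp_add_right (coeFn_phaseMul (-y) (F u)) a] with ξ h1 h2
  rw [crossTerm, crossTerm, h1, h2, map_mul, conj_phase, neg_neg, phase_add_right]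
  have := phase_mul_phase_neg y ξ
  linear_combination (F f : Rd d → ℂ) ξ * (starRingEnd ℂ) ((F u : Rd d → ℂ) (ξ + a)) * k ξ *
    phase y a * this

lemma alphaSum_ae_eq_zero_of_commutes [Countable P] (hF : IsFourier F)
    (hC : ∀ p, IsUnit (C p).det) (hg : LocBound F C g) (hh : LocBound F C h)
    (hT : IsTrans T) (hΩ : IsOmega T C C g h Ω) (hc : ∀ y f, Ω (T y f) = T y (Ω f))
    {β : Rd d} (hβ : β ≠ 0) : ∀ᵐ ξ, alphaSum F C g h β ξ = 0 := by
  have hK := locSummable_omegaKer hg hh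
  have h1 := hK.fiberSum_ae_eq_zero β fun φ ψ hφ hψ => by
    obtain ⟨f, hf⟩ := exists_fourier_eq F hφ
    obtain ⟨u, hu⟩ := exists_fourier_eq F hψ
    have hf' := hφ.congr hf.symm
    have hu' := hψ.congr hu.symm
    have h2 := tsum_coeff_eq_zero (hK.summable_integral_crossTerm hf' hu') (freq C)
      (c := inner ℂ u (Ω f)) (fun y => by
        rw [← inner_trans_trans hF hT y, ← hc, inner_omega hF hC hK hT hΩ
          (bddCompactSupp_trans hF hT y hf') (bddCompactSupp_trans hF hT y hu')]
        simp only [integral_crossTerm_trans hF hT]) hβ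
    rw [← h2]
    refine tsum_congr fun i => ?_
    congr 1
    refine integral_congr_ae ?_
    filter_upwards [hf, ae_comp_add_right hu (freq C i)] with ξ h3 h4
    rw [crossTerm, crossTerm, h3, h4]
  simpa only [fiberSum_omegaKer hC] using h1

lemma ae_eq_mul_of_integral_crossTerm {v : L2 d} {φ S : Rd d → ℂ}
    (hi : ∀ ψ, BddCompactSupp ψ → Integrable (crossTerm φ ψ 0 S) volume)
    (hv : ∀ ψ, BddCompactSupp ψ →
      ∫ ξ, (v : Rd d → ℂ) ξ * (starRingEnd ℂ) (ψ ξ) = ∫ ξ, crossTerm φ ψ 0 S ξ) :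
    (v : Rd d → ℂ) =ᵐ[volume] fun ξ => S ξ * φ ξ := by
  have key : ∀ n : ℕ, ∀ᵐ ξ : Rd d, ‖ξ‖ ≤ n → (v : Rd d → ℂ) ξ = S ξ * φ ξ := by
    intro n
    let χ : Rd d → ℂ := (Metric.closedBall (0 : Rd d) n).indicator fun _ => (1 : ℂ)
    have hb : BddCompactSupp χ := BddCompactSupp.indicator_closedBall (d := d) n
    have hvi : ∀ ψ, BddCompactSupp ψ →
        Integrable (fun ξ => (v : Rd d → ℂ) ξ * (starRingEnd ℂ) (ψ ξ)) volume := fun ψ hψ => by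
      refine (L2.integrable_inner (𝕜 := ℂ) ((hψ.memLp 2).toLp ψ) v).congr ?_
      filter_upwards [(hψ.memLp 2).coeFn_toLp] with ξ h1
      rw [h1, RCLike.inner_apply]
    have h1 := ((hvi χ hb).sub (hi χ hb)).ae_eq_zero_of_forall_setIntegral_eq_zero
      fun A hA _ => by
        have h2 := hv _ (hb.indicator hA)
        rw [← sub_eq_zero, ← integral_sub (hvi _ (hb.indicator hA)) (hi _ (hb.indicator hA))] at h2
        rw [← integral_indicator hA, ← h2]
        refine integral_congr_ae (Filter.Eventually.of_forall fun ξ => ?_)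
        by_cases hξ : ξ ∈ A <;> simp [crossTerm, hξ]
    filter_upwards [h1] with ξ h2 h3
    have h5 : ξ ∈ Metric.closedBall (0 : Rd d) n := by simpa using h3
    have h6 : (v : Rd d → ℂ) ξ - φ ξ * S ξ = 0 := by simpa [χ, crossTerm, h5] using h2
    rw [mul_comm]
    exact sub_eq_zero.1 h6
  filter_upwards [ae_all_iff.2 key] with ξ h1
  obtain ⟨n, hn⟩ := exists_nat_ge ‖ξ‖
  exact h1 n hn

lemma fourier_omega_of_bddCompactSupp [Countable P] (hF : IsFourier F)
    (hC : ∀ p, IsUnit (C p).det) (hg : LocBound F C g) (hh : LocBound F C h)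
    (hT : IsTrans T) (hΩ : IsOmega T C C g h Ω)
    (h0 : ∀ β, β ≠ 0 → ∀ᵐ ξ, alphaSum F C g h β ξ = 0)
    {f : L2 d} (hf : BddCompactSupp (F f : Rd d → ℂ)) :
    (F (Ω f) : Rd d → ℂ) =ᵐ[volume] fun ξ => alphaSum F C g h 0 ξ * (F f : Rd d → ℂ) ξ := by
  have hK := locSummable_omegaKer hg hh
  have hS : ∀ β, fiberSum (freq C) (omegaKer F C g h) β = alphaSum F C g h β := fun β =>
    funext fun ξ => fiberSum_omegaKer hC β ξ
  refine ae_eq_mul_of_integral_crossTerm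
    (fun ψ hψ => hS 0 ▸ (hK.integrable_crossTerm_fiberSum hf hψ 0).1) fun ψ hψ => ?_
  obtain ⟨u, hu⟩ := exists_fourier_eq F hψ
  have hu' := hψ.congr hu.symm
  have h1 := inner_omega hF hC hK hT hΩ hf hu'
  rw [hK.tsum_integral_eq_of_fiberSum_eq_zero (fun β hβ => hS β ▸ h0 β hβ) hf hu', hS,
    ← F.inner_map_map, L2.inner_def] at h1
  calc ∫ ξ, (F (Ω f) : Rd d → ℂ) ξ * (starRingEnd ℂ) (ψ ξ)
      = ∫ ξ, inner ℂ ((F u : Rd d → ℂ) ξ) ((F (Ω f) : Rd d → ℂ) ξ) := by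
        refine integral_congr_ae ?_
        filter_upwards [hu] with ξ h2
        rw [h2, RCLike.inner_apply]
    _ = _ := h1
    _ = _ := by
        refine integral_congr_ae ?_
        filter_upwards [ae_comp_add_right hu 0] with ξ h2
        rw [crossTerm, crossTerm, h2]

end Operator

lemma dense_bddCompactSupp {d : ℕ} :
    Dense {v : L2 d | BddCompactSupp (v : Rd d → ℂ)} := by
  refine (Lp.dense_hasCompactSupport_contDiff (μ := (volume : Measure (Rd d))) (F := ℂ)
    (p := 2) (by norm_num)).mono ?_
  rintro v ⟨w, hvw, hw, hw'⟩
  refine BddCompactSupp.congr ⟨hw'.continuous.aestronglyMeasurable, ?_, ?_⟩ hvw.symm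
  · obtain ⟨M, hM⟩ := hw'.continuous.bounded_above_of_compact_support hw
    exact ⟨M, Filter.Eventually.of_forall hM⟩
  · obtain ⟨R, hR⟩ := hw.isCompact.isBounded.exists_norm_le
    exact ⟨R, Filter.Eventually.of_forall fun ξ hξ => hR ξ (subset_tsupport w hξ)⟩

lemma exists_seq_bddCompactSupp_tendsto {d : ℕ} (F : L2 d ≃ₗᵢ[ℂ] L2 d) (f : L2 d) :
    ∃ u : ℕ → L2 d, (∀ n, BddCompactSupp (F (u n) : Rd d → ℂ)) ∧
      Filter.Tendsto u Filter.atTop (nhds f) := by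
  obtain ⟨v, hv, hlim⟩ := mem_closure_iff_seq_limit.1 (dense_bddCompactSupp (F f))
  refine ⟨fun n => F.symm (v n), fun n => ?_, ?_⟩
  · rw [F.apply_symm_apply]
    exact hv n
  · have h1 := (F.symm.continuous.tendsto (F f)).comp hlim
    rwa [F.symm_apply_apply] at h1

lemma exists_subseq_tendsto_ae {d : ℕ} {v : ℕ → L2 d} {w : L2 d}
    (h : Filter.Tendsto v Filter.atTop (nhds w)) : ∃ ns : ℕ → ℕ, StrictMono ns ∧
      ∀ᵐ ξ, Filter.Tendsto (fun i => (v (ns i) : Rd d → ℂ) ξ) Filter.atTop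
        (nhds ((w : Rd d → ℂ) ξ)) :=
  (tendstoInMeasure_of_tendsto_Lp h).exists_seq_tendsto_ae

lemma IsOmega.continuous {d : ℕ} {P : Type*} [Countable P] {T : Rd d → L2 d → L2 d}
    {C D : P → Matrix (Fin d) (Fin d) ℝ} {g h : P → L2 d} {Ω : L2 d → L2 d}
    (hT : IsTrans T) (hΩ : IsOmega T C D g h Ω) : Continuous Ω := by
  let A : Finset (P × (Fin d → ℤ)) → (L2 d →L[ℂ] L2 d) := fun s => ∑ pk ∈ s,
    (innerSL ℂ (T (mApp (C pk.1) (zv pk.2)) (g pk.1))).smulRight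
      (T (mApp (D pk.1) (zv pk.2)) (h pk.1))
  have hA : Filter.Tendsto (fun s f => A s f) Filter.atTop (nhds Ω) := by
    refine tendsto_pi_nhds.2 fun f => ?_
    have h1 : Filter.Tendsto _ Filter.atTop (nhds (Ω f)) := hΩ f
    refine h1.congr fun s => ?_
    simp only [A, _root_.sum_apply, ContinuousLinearMap.smulRight_apply, innerSL_apply_apply,
      pair_eq_inner hT]
  exact (continuousLinearMapOfTendsto A hA).continuous

section Multiplier

variable {d : ℕ} {P : Type*} [Countable P] {F : L2 d ≃ₗᵢ[ℂ] L2 d}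
  {C : P → Matrix (Fin d) (Fin d) ℝ} {g h : P → L2 d} {T : Rd d → L2 d → L2 d} {Ω : L2 d → L2 d}

lemma fourier_omega (hF : IsFourier F) (hC : ∀ p, IsUnit (C p).det)
    (hg : LocBound F C g) (hh : LocBound F C h) (hT : IsTrans T) (hΩ : IsOmega T C C g h Ω)
    (h0 : ∀ β, β ≠ 0 → ∀ᵐ ξ, alphaSum F C g h β ξ = 0) (f : L2 d) :
    (F (Ω f) : Rd d → ℂ) =ᵐ[volume] fun ξ => alphaSum F C g h 0 ξ * (F f : Rd d → ℂ) ξ := by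
  obtain ⟨u, hu, hlim⟩ := exists_seq_bddCompactSupp_tendsto F f
  obtain ⟨ns, hns, h1⟩ := exists_subseq_tendsto_ae ((F.continuous.tendsto f).comp hlim)
  obtain ⟨ms, hms, h2⟩ := exists_subseq_tendsto_ae
    (((F.continuous.comp (hΩ.continuous hT)).tendsto f).comp (hlim.comp hns.tendsto_atTop))
  have h3 := ae_all_iff.2 fun n => fourier_omega_of_bddCompactSupp hF hC hg hh hT hΩ h0 (hu n)
  filter_upwards [h1, h2, h3] with ξ h4 h5 h6
  refine tendsto_nhds_unique h5 ?_
  refine (((h4.comp hms.tendsto_atTop).const_mul (alphaSum F C g h 0 ξ))).congr fun n => ?_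
  exact (h6 _).symm

lemma commutes_of_fourier_multiplier (hF : IsFourier F) (hT : IsTrans T) {s : Rd d → ℂ}
    (hs : ∀ f : L2 d, (F (Ω f) : Rd d → ℂ) =ᵐ[volume] fun ξ => s ξ * (F f : Rd d → ℂ) ξ)
    (y : Rd d) (f : L2 d) : Ω (T y f) = T y (Ω f) := by
  refine F.injective (Lp.ext ?_)
  have h1 := hs (T y f)
  rw [hF.map_trans hT] at h1 ⊢
  filter_upwards [h1, hs f, coeFn_phaseMul (-y) (F f), coeFn_phaseMul (-y) (F (Ω f))]
    with ξ h2 h3 h4 h5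
  rw [h2, h4, h5, h3]
  ring

end Multiplier

/-- Lemma 1 of the paper. With `G = {T_{C_p k} g_p}` and
`H = {T_{C_p k} h_p}` Bessel and locally bounded, and `Ω = Ω_{H,G}` the operator
`f ↦ Σ_p Σ_k ⟨f, T_{C_p k} g_p⟩ T_{C_p k} h_p`, the operator `Ω` commutes with every
translation `T_y` iff for every `α ∈ Λ \ {0}` one has
`Σ_{p ∈ P_α} |det C_p|⁻¹ conj(ĝ_p(ξ)) ĥ_p(ξ+α) = 0` a.e.; in that case `Ω` is the Fourier
multiplier with symbol `s(ξ) = Σ_p |det C_p|⁻¹ conj(ĝ_p(ξ)) ĥ_p(ξ)`. -/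
theorem omega_commutes_iff {d : ℕ} (hd : 1 ≤ d) {P : Type} [Countable P]
    (F : L2 d ≃ₗᵢ[ℂ] L2 d) (hF : IsFourier F)
    (C : P → Matrix (Fin d) (Fin d) ℝ) (hC : ∀ p, IsUnit (C p).det)
    (g h : P → L2 d)
    (hGb : Bessel C g) (hHb : Bessel C h)
    (hGl : LocBound F C g) (hHl : LocBound F C h)
    (T : Rd d → L2 d → L2 d) (hT : IsTrans T)
    (Ω : L2 d → L2 d) (hΩ : IsOmega T C C g h Ω) :
    ((∀ (y : Rd d) (f : L2 d), Ω (T y f) = T y (Ω f)) ↔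
      ∀ α : Rd d, memLambda C α → α ≠ 0 →
        ∀ᵐ ξ ∂(volume : Measure (Rd d)), alphaSum F C g h α ξ = 0) ∧
    ((∀ (y : Rd d) (f : L2 d), Ω (T y f) = T y (Ω f)) →
      ∀ f : L2 d, (F (Ω f) : Rd d → ℂ) =ᵐ[volume] fun ξ =>
        (∑' p : P, ((|(C p).det|⁻¹ : ℝ) : ℂ) * (starRingEnd ℂ) ((F (g p) : Rd d → ℂ) ξ) *
          (F (h p) : Rd d → ℂ) ξ) * (F f : Rd d → ℂ) ξ) := by
  refine ⟨⟨fun hc α _ hα => alphaSum_ae_eq_zero_of_commutes hF hC hGl hHl hT hΩ hc hα,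
    fun h0 => ?_⟩, fun hc f => ?_⟩
  · refine commutes_of_fourier_multiplier hF hT
      (fourier_omega hF hC hGl hHl hT hΩ fun β hβ => ?_)
    by_cases hΛ : memLambda C β
    · exact h0 β hΛ hβ
    · exact Filter.Eventually.of_forall (alphaSum_eq_zero_of_not_memLambda hC hΛ)
  · simp only [← alphaSum_zero]
    exact fourier_omega hF hC hGl hHl hT hΩ
      (fun β hβ => alphaSum_ae_eq_zero_of_commutes hF hC hGl hHl hT hΩ hc hβ) f

end GSL
end
end
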